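/- arXiv:2010.00103 — 4 statements merged into one kernel-verified Lean document; each statement's English description precedes it below -/
import Mathlib

section
/- Let N be a weight sequence in the class 𝓛𝓒 which is nonquasianalytic, and let s ∈ ℕ_{>0}. Then the sequence L^s satisfies condition (L^s,N)_{SV}; more precisely, for this same s one has λ^{L^s,N}_{p,s} ≤ p/(∑_{k≥p} 1/ν_k) for every p ≥ 1, and hence sup_{p≥1} (λ^{L^s,N}_{p,s}/p)·∑_{k≥p} 1/ν_k ≤ 1. -/
open Filter

noncomputable def nuq (N : ℕ → ℝ) (p : ℕ) : ℝ := N p / N (p - 1)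

def IsLC (N : ℕ → ℝ) : Prop :=
  (∀ p, 0 < N p) ∧ N 0 = 1 ∧ N 0 ≤ N 1 ∧
    (∀ p, 1 ≤ p → (N p) ^ 2 ≤ N (p - 1) * N (p + 1)) ∧
    Tendsto (fun p : ℕ => (N p) ^ ((1 : ℝ) / p)) atTop atTop

def NQA (N : ℕ → ℝ) : Prop := Summable (fun p : ℕ => 1 / nuq N (p + 1))

noncomputable def tailSum (N : ℕ → ℝ) (p : ℕ) : ℝ := ∑' k : ℕ, 1 / nuq N (p + k)

noncomputable def lamSV (M N : ℕ → ℝ) (s p : ℕ) : ℝ :=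
  ⨆ j : Fin p, (M p / ((s : ℝ) ^ p * N j)) ^ ((1 : ℝ) / ((p : ℝ) - (j : ℕ)))

def SVcond (M N : ℕ → ℝ) : Prop :=
  ∃ s : ℕ, 1 ≤ s ∧ ∃ B : ℝ, ∀ p : ℕ, 1 ≤ p → lamSV M N s p / p * tailSum N p ≤ B

noncomputable def Lseq (N : ℕ → ℝ) (s p : ℕ) : ℝ :=
  if p = 0 then 1
  else (s : ℝ) ^ p * ⨅ j : Fin p, ((p : ℝ) / tailSum N p) ^ (p - (j : ℕ)) * N j

noncomputable def LseqC (N : ℕ → ℝ) (s : ℕ) (C : ℝ) (p : ℕ) : ℝ :=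
  if p = 0 then 1
  else (s : ℝ) ^ p * ⨅ j : Fin p, (C * p / tailSum N p) ^ (p - (j : ℕ)) * N j

def Preceq (M N : ℕ → ℝ) : Prop :=
  ∃ B : ℝ, ∀ p : ℕ, 1 ≤ p → (M p / N p) ^ ((1 : ℝ) / p) ≤ B

def SeqEquiv (M N : ℕ → ℝ) : Prop := Preceq M N ∧ Preceq N M

def Gamma1 (N : ℕ → ℝ) : Prop :=
  ∃ B : ℝ, ∀ p : ℕ, 1 ≤ p → nuq N p / p * tailSum N p ≤ B

def MG (N : ℕ → ℝ) : Prop :=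
  ∃ C : ℝ, 1 ≤ C ∧ ∀ j k : ℕ, N (j + k) ≤ C ^ (j + k) * N j * N k

noncomputable def tauD (N : ℕ → ℝ) (p : ℕ) : ℝ := p / nuq N p + tailSum N p

noncomputable def sigmaD (N : ℕ → ℝ) (p : ℕ) : ℝ :=
  if p = 0 then 1 else tauD N 1 * p / tauD N p

noncomputable def Sdesc (N : ℕ → ℝ) (p : ℕ) : ℝ :=
  ∏ i ∈ Finset.range (p + 1), sigmaD N i

def AlmostIncreasing (a : ℕ → ℝ) : Prop :=
  ∃ C : ℝ, 1 ≤ C ∧ ∀ p q : ℕ, 1 ≤ p → p ≤ q → a p ≤ C * a q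

noncomputable def BorelMap (f : ℝ → ℂ) : ℕ → ℂ := fun p => iteratedDeriv p f 0

def DRoumieu (N : ℕ → ℝ) : Set (ℝ → ℂ) :=
  {f | ContDiff ℝ (⊤ : ℕ∞) f ∧ Function.support f ⊆ Set.Icc (-1 : ℝ) 1 ∧
    ∃ C h : ℝ, 0 < C ∧ 0 < h ∧ ∀ p x, ‖iteratedDeriv p f x‖ ≤ C * h ^ p * N p}

def LambdaRoumieu (M : ℕ → ℝ) : Set (ℕ → ℂ) :=
  {a | ∃ C h : ℝ, 0 < C ∧ 0 < h ∧ ∀ p, ‖a p‖ ≤ C * h ^ p * M p}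

def DBeurling (N : ℕ → ℝ) : Set (ℝ → ℂ) :=
  {f | ContDiff ℝ (⊤ : ℕ∞) f ∧ Function.support f ⊆ Set.Icc (-1 : ℝ) 1 ∧
    ∀ h : ℝ, 0 < h → ∃ C : ℝ, 0 < C ∧ ∀ p x, ‖iteratedDeriv p f x‖ ≤ C * h ^ p * N p}

def LambdaBeurling (M : ℕ → ℝ) : Set (ℕ → ℂ) :=
  {a | ∀ h : ℝ, 0 < h → ∃ C : ℝ, 0 < C ∧ ∀ p, ‖a p‖ ≤ C * h ^ p * M p}

theorem tailSum_nonneg {N : ℕ → ℝ} (hN : ∀ p, 0 < N p) (p : ℕ) : 0 ≤ tailSum N p :=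
  tsum_nonneg fun _ => one_div_nonneg.2 (div_pos (hN _) (hN _)).le

/-- The minimum defining `Lseq` is nonnegative and at most each of its terms. -/
theorem iInf_pow_mul_mem_Icc {N : ℕ → ℝ} (hN : ∀ p, 0 < N p) {a : ℝ} (ha : 0 ≤ a) {p : ℕ}
    (j : Fin p) :
    (⨅ i : Fin p, a ^ (p - (i : ℕ)) * N i) ∈ Set.Icc 0 (a ^ (p - (j : ℕ)) * N j) :=
  ⟨Real.iInf_nonneg fun i => mul_nonneg (pow_nonneg ha _) (hN i).le,
    ciInf_le (Set.finite_range _).bddBelow j⟩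

theorem lamSV_Lseq_le {N : ℕ → ℝ} (hN : ∀ p, 0 < N p) {s : ℕ} (hs : 1 ≤ s) {p : ℕ}
    (hp : 1 ≤ p) : lamSV (Lseq N s) N s p ≤ (p : ℝ) / tailSum N p := by
  have ha : 0 ≤ (p : ℝ) / tailSum N p := div_nonneg p.cast_nonneg (tailSum_nonneg hN p)
  refine Real.iSup_le (fun j => ?_) ha
  have hs' : (s : ℝ) ^ p ≠ 0 := pow_ne_zero _ (Nat.cast_ne_zero.2 (by lia))
  obtain ⟨h0, hle⟩ := iInf_pow_mul_mem_Icc hN ha j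
  rw [Lseq, if_neg (by lia), mul_div_mul_left _ _ hs', ← Nat.cast_sub j.2.le, one_div]
  calc _ ≤ (((p : ℝ) / tailSum N p) ^ (p - (j : ℕ))) ^ (((p - (j : ℕ) : ℕ) : ℝ)⁻¹) :=
        Real.rpow_le_rpow (div_nonneg h0 (hN j).le) ((div_le_iff₀ (hN j)).2 hle) (by positivity)
    _ = _ := Real.pow_rpow_inv_natCast ha (Nat.sub_ne_zero_of_lt j.2)

theorem lamSV_Lseq_div_mul_tailSum_le_one {N : ℕ → ℝ} (hN : ∀ p, 0 < N p) {s : ℕ} (hs : 1 ≤ s)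
    {p : ℕ} (hp : 1 ≤ p) : lamSV (Lseq N s) N s p / p * tailSum N p ≤ 1 := by
  have hp' : (0 : ℝ) < p := by exact_mod_cast hp
  rw [div_mul_eq_mul_div, div_le_one hp']
  exact mul_le_of_le_div₀ hp'.le (tailSum_nonneg hN p) (lamSV_Lseq_le hN hs hp)

theorem stmt0 (N : ℕ → ℝ) (hN : IsLC N) (hnq : NQA N) (s : ℕ) (hs : 1 ≤ s) :
    SVcond (Lseq N s) N ∧
    (∀ p : ℕ, 1 ≤ p → lamSV (Lseq N s) N s p ≤ (p : ℝ) / tailSum N p) ∧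
    (∀ p : ℕ, 1 ≤ p → lamSV (Lseq N s) N s p / p * tailSum N p ≤ 1) := by
  have h1 : ∀ p : ℕ, 1 ≤ p → lamSV (Lseq N s) N s p / p * tailSum N p ≤ 1 :=
    fun _ hp => lamSV_Lseq_div_mul_tailSum_le_one hN.1 hs hp
  exact ⟨⟨s, hs, 1, h1⟩, fun _ hp => lamSV_Lseq_le hN.1 hs hp, h1⟩
end

section
/- Let N be a weight sequence in the class 𝓛𝓒 which is nonquasianalytic, and let M : ℕ → ℝ_{>0} be any sequence satisfying condition (M,N)_{SV}. Then M ⪯ L^s for every s ∈ ℕ_{>0}. -/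
open Filter

theorem tailSum_pos {N : ℕ → ℝ} (hN : ∀ p, 0 < N p) (hnq : NQA N) {p : ℕ} (hp : 1 ≤ p) :
    0 < tailSum N p := by
  have hpos : ∀ k, 0 < 1 / nuq N (p + k) := fun k => one_div_pos.2 (div_pos (hN _) (hN _))
  have hsum : Summable fun k : ℕ => 1 / nuq N (p + k) := by
    refine ((summable_nat_add_iff (p - 1)).2 hnq).congr fun k => ?_
    rw [show k + (p - 1) + 1 = p + k by omega]
  exact hsum.tsum_pos (fun k => (hpos k).le) 0 (hpos 0)

theorem le_of_lamSV_le {M N : ℕ → ℝ} {s p : ℕ} {A : ℝ} (hM : 0 < M p) (hN : ∀ j, 0 < N j)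
    (hs : 1 ≤ s) (hA : lamSV M N s p ≤ A) (j : Fin p) :
    M p ≤ (s : ℝ) ^ p * (A ^ (p - (j : ℕ)) * N j) := by
  have hs' : (0 : ℝ) < s := by exact_mod_cast hs
  have hden : 0 < (s : ℝ) ^ p * N j := mul_pos (pow_pos hs' p) (hN j)
  have hroot := (le_ciSup (f := fun j : Fin p =>
    (M p / ((s : ℝ) ^ p * N j)) ^ ((1 : ℝ) / ((p : ℝ) - (j : ℕ))))
    (Set.finite_range _).bddAbove j).trans hA
  have hpow := pow_le_pow_left₀ (Real.rpow_nonneg (div_pos hM hden).le _) hroot (p - (j : ℕ))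
  rw [← Nat.cast_sub j.2.le, one_div,
    Real.rpow_inv_natCast_pow (div_pos hM hden).le (Nat.sub_ne_zero_of_lt j.2),
    div_le_iff₀ hden] at hpow
  linarith

theorem stmt1 (N : ℕ → ℝ) (hN : IsLC N) (hnq : NQA N)
    (M : ℕ → ℝ) (hMpos : ∀ p, 0 < M p) (hSV : SVcond M N) :
    ∀ s : ℕ, 1 ≤ s → Preceq M (Lseq N s) := by
  intro t ht
  obtain ⟨hpos, -⟩ := hN
  obtain ⟨s, hs, B, hB⟩ := hSV
  have hs1 : (1 : ℝ) ≤ s := by exact_mod_cast hs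
  have ht1 : (1 : ℝ) ≤ t := by exact_mod_cast ht
  set C := max B 1
  have hC1 : 1 ≤ C := le_max_right _ _
  have hK : 0 < (s : ℝ) * C := by positivity
  refine ⟨s * C, fun p hp => ?_⟩
  have hp0 : (0 : ℝ) < p := by exact_mod_cast hp
  have hT := tailSum_pos hpos hnq hp
  have hlam : lamSV M N s p ≤ C * (p / tailSum N p) := by
    have h := (hB p hp).trans (le_max_left B 1)
    rw [div_mul_eq_mul_div, div_le_iff₀ hp0] at h
    rwa [← mul_div_assoc, le_div_iff₀ hT]
  have : Nonempty (Fin p) := ⟨⟨0, hp⟩⟩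
  have hinf : M p / (s * C) ^ p ≤
      ⨅ j : Fin p, ((p : ℝ) / tailSum N p) ^ (p - (j : ℕ)) * N j := by
    refine le_ciInf fun j => ?_
    rw [div_le_iff₀ (pow_pos hK p)]
    have hNj := hpos j
    calc M p ≤ (s : ℝ) ^ p * ((C * (p / tailSum N p)) ^ (p - (j : ℕ)) * N j) :=
          le_of_lamSV_le (hMpos p) hpos hs hlam j
      _ = (s : ℝ) ^ p * (C ^ (p - (j : ℕ)) * ((p / tailSum N p) ^ (p - (j : ℕ)) * N j)) := by
          rw [mul_pow, mul_assoc]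
      _ ≤ (s : ℝ) ^ p * (C ^ p * ((p / tailSum N p) ^ (p - (j : ℕ)) * N j)) := by
          gcongr
          exact Nat.sub_le _ _
      _ = _ := by rw [mul_pow]; ring
  have hLinf : M p / (s * C) ^ p ≤ Lseq N t p := by
    rw [Lseq, if_neg (by omega)]
    exact hinf.trans (le_mul_of_one_le_left
      ((div_pos (hMpos p) (pow_pos hK p)).le.trans hinf) (one_le_pow₀ ht1))
  have hL : 0 < Lseq N t p := (div_pos (hMpos p) (pow_pos hK p)).trans_le hLinf
  have hML : M p / Lseq N t p ≤ (s * C) ^ p := by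
    rwa [div_le_iff₀ hL, mul_comm, ← div_le_iff₀ (pow_pos hK p)]
  calc (M p / Lseq N t p) ^ ((1 : ℝ) / p) ≤ ((s * C) ^ p) ^ ((1 : ℝ) / p) :=
        Real.rpow_le_rpow (div_pos (hMpos p) hL).le hML (by positivity)
    _ = s * C := by rw [one_div, Real.pow_rpow_inv_natCast hK.le (by omega)]
end

section
/- Let N be a weight sequence in the class 𝓛𝓒 which is nonquasianalytic. Then L^s ⪯ N for every s ∈ ℕ_{>0}. -/
open Filter

/-- The tail sum dominates its leading term. -/
theorem one_div_nuq_le_tailSum {N : ℕ → ℝ} (hpos : ∀ p, 0 < N p) (hnq : NQA N)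
    {p : ℕ} (hp : 1 ≤ p) : 1 / nuq N p ≤ tailSum N p := by
  obtain ⟨q, rfl⟩ := Nat.exists_eq_add_of_le' hp
  have hsum : Summable (fun k : ℕ => 1 / nuq N (q + 1 + k)) := by
    have h := (summable_nat_add_iff q).2 hnq
    refine h.congr fun k => ?_
    rw [show k + q + 1 = q + 1 + k by omega]
  have hnonneg : ∀ k : ℕ, 0 ≤ 1 / nuq N (q + 1 + k) := fun k =>
    one_div_nonneg.2 (div_pos (hpos _) (hpos _)).le
  exact hsum.le_tsum 0 fun k _ => hnonneg k

/-- The term `j = p - 1` of the minimum defining `Lseq` gives `Lseq N s p ≤ s ^ p * p * N p`. -/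
theorem Lseq_le {N : ℕ → ℝ} (hpos : ∀ p, 0 < N p) (hnq : NQA N) (s : ℕ)
    {p : ℕ} (hp : 1 ≤ p) : Lseq N s p ≤ (s : ℝ) ^ p * (p * N p) := by
  have hν : 0 < nuq N p := div_pos (hpos _) (hpos _)
  have htail := one_div_nuq_le_tailSum hpos hnq hp
  have hT : 0 < tailSum N p := (one_div_pos.2 hν).trans_le htail
  rw [Lseq, if_neg (by omega)]
  refine mul_le_mul_of_nonneg_left ?_ (by positivity)
  refine (ciInf_le (Set.finite_range _).bddBelow (⟨p - 1, by omega⟩ : Fin p)).trans ?_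
  have hN : N p = nuq N p * N (p - 1) := (div_mul_cancel₀ _ (hpos _).ne').symm
  have hdiv : (p : ℝ) / tailSum N p ≤ p * nuq N p := by
    rw [div_le_iff₀ hT, mul_assoc]
    refine le_mul_of_one_le_right (by positivity) ?_
    rwa [div_le_iff₀ hν, mul_comm] at htail
  simp only [Nat.sub_sub_self hp, pow_one]
  rw [hN, ← mul_assoc]
  exact mul_le_mul_of_nonneg_right hdiv (hpos _).le

/-- `Lseq` is nonnegative. -/
theorem Lseq_nonneg {N : ℕ → ℝ} (hpos : ∀ p, 0 < N p) (s p : ℕ) : 0 ≤ Lseq N s p := by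
  have hT : 0 ≤ tailSum N p := tsum_nonneg fun k =>
    one_div_nonneg.2 (div_pos (hpos _) (hpos _)).le
  unfold Lseq
  split_ifs
  · exact zero_le_one
  · exact mul_nonneg (by positivity) (Real.iInf_nonneg fun j =>
      mul_nonneg (by positivity) (hpos _).le)

theorem stmt2 (N : ℕ → ℝ) (hN : IsLC N) (hnq : NQA N) :
    ∀ s : ℕ, 1 ≤ s → Preceq (Lseq N s) N := by
  intro s _
  obtain ⟨hpos, -⟩ := hN
  refine ⟨2 * s, fun p hp => ?_⟩
  have hbound : Lseq N s p / N p ≤ (2 * s : ℝ) ^ p := by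
    rw [div_le_iff₀ (hpos p)]
    have h2 : (p : ℝ) ≤ 2 ^ p := by exact_mod_cast Nat.lt_two_pow_self.le
    calc Lseq N s p ≤ (s : ℝ) ^ p * (p * N p) := Lseq_le hpos hnq s hp
      _ ≤ (s : ℝ) ^ p * (2 ^ p * N p) := by
        have := (hpos p).le
        gcongr
      _ = (2 * s : ℝ) ^ p * N p := by rw [mul_pow]; ring
  have hroot := Real.rpow_le_rpow (div_nonneg (Lseq_nonneg hpos s p) (hpos p).le) hbound
    (by positivity : (0 : ℝ) ≤ 1 / p)
  rwa [one_div, Real.pow_rpow_inv_natCast (by positivity) (by omega), ← one_div] at hroot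
end

section
/- (Beurling case of the main theorem.) Let N be a weight sequence in the class 𝓛𝓒 which is nonquasianalytic and let s ∈ ℕ_{>0}. Then: (a) (L^s_p/p!)^{1/p} → +∞, L^s ⪯ N, and Λ_{(L^s)} ⊆ ℬ(𝒟_{(N)}([-1,1])); (b) every sequence M : ℕ → ℝ_{>0} with (M_p/p!)^{1/p} → +∞, M ⪯ N, and Λ_{(M)} ⊆ ℬ(𝒟_{(N)}([-1,1])) satisfies M ⪯ L^s. In other words, L^s is a ⪯-maximal element of the set of sequences M with (M_p/p!)^{1/p} → +∞, M ⪯ N and Λ_{(M)} contained in the image of the Borel map on 𝒟_{(N)}([-1,1]). -/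
open Filter

namespace BorelBeurling

section WeightSequence

variable {N : ℕ → ℝ}

lemma nuq_succ_mul (hN : IsLC N) (k : ℕ) : nuq N (k + 1) * N k = N (k + 1) := by
  have := (hN.1 k).ne'
  simp [nuq, this]

lemma nuq_pos (hN : IsLC N) (k : ℕ) : 0 < nuq N k :=
  div_pos (hN.1 _) (hN.1 _)

lemma nuq_le_succ (hN : IsLC N) (k : ℕ) : nuq N k ≤ nuq N (k + 1) := by
  obtain ⟨hpos, h0, h1, hlc, -⟩ := hN
  rcases Nat.eq_zero_or_pos k with rfl | hk
  · simpa [nuq, h0] using h1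
  · simp only [nuq, Nat.add_sub_cancel]
    rw [div_le_div_iff₀ (hpos _) (hpos _)]
    nlinarith [hlc k hk]

lemma nuq_monotone (hN : IsLC N) : Monotone (nuq N) := monotone_nat_of_le_succ (nuq_le_succ hN)

lemma one_le_nuq (hN : IsLC N) (k : ℕ) : 1 ≤ nuq N k := by
  have h := nuq_monotone hN (Nat.zero_le k)
  have h0 : nuq N 0 = 1 := by simp [nuq, hN.2.1]
  linarith

lemma one_le_weight (hN : IsLC N) (k : ℕ) : 1 ≤ N k := by
  induction k with
  | zero => exact hN.2.1.ge
  | succ k ih =>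
    rw [← nuq_succ_mul hN]
    nlinarith [one_le_nuq hN (k + 1)]

lemma weight_add (hN : IsLC N) (p m : ℕ) :
    N (p + m) = N p * ∏ i ∈ Finset.range m, nuq N (p + 1 + i) := by
  induction m with
  | zero => simp
  | succ m ih =>
    rw [Finset.prod_range_succ, ← mul_assoc, ← ih, show p + 1 + m = p + m + 1 by ring, mul_comm,
      nuq_succ_mul hN, add_assoc]

lemma summable_inv_nuq (hnq : NQA N) : Summable fun k => 1 / nuq N k :=
  (summable_nat_add_iff 1).1 hnq

lemma summable_inv_nuq_add (hnq : NQA N) (p : ℕ) : Summable fun k => 1 / nuq N (p + k) := by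
  simpa only [add_comm] using (summable_nat_add_iff p).2 (summable_inv_nuq hnq)

lemma tailSum_eq (hnq : NQA N) (p : ℕ) : tailSum N p = 1 / nuq N p + tailSum N (p + 1) := by
  rw [tailSum, (summable_inv_nuq_add hnq p).tsum_eq_zero_add]
  simp [tailSum, add_comm, add_left_comm]

lemma tailSum_pos (hN : IsLC N) (hnq : NQA N) (p : ℕ) : 0 < tailSum N p :=
  (summable_inv_nuq_add hnq p).tsum_pos (fun _ => (one_div_pos.2 (nuq_pos hN _)).le) 0
    (one_div_pos.2 (nuq_pos hN _))

lemma tailSum_succ_le (hN : IsLC N) (hnq : NQA N) (p : ℕ) : tailSum N (p + 1) ≤ tailSum N p := by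
  have := one_div_pos.2 (nuq_pos hN p)
  linarith [tailSum_eq hnq p]

lemma tailSum_antitone (hN : IsLC N) (hnq : NQA N) : Antitone (tailSum N) :=
  antitone_nat_of_succ_le (tailSum_succ_le hN hnq)

lemma tendsto_tailSum (N : ℕ → ℝ) : Tendsto (tailSum N) atTop (nhds 0) := by
  have h := tendsto_sum_nat_add fun k => 1 / nuq N k
  simp only [add_comm] at h
  exact h

lemma sum_inv_nuq_le_tailSum (hN : IsLC N) (hnq : NQA N) (p m : ℕ) :
    ∑ i ∈ Finset.range m, 1 / nuq N (p + i) ≤ tailSum N p :=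
  (summable_inv_nuq_add hnq p).sum_le_tsum _ fun _ _ => (one_div_pos.2 (nuq_pos hN _)).le

lemma exists_half_tailSum_le_sum (hN : IsLC N) (hnq : NQA N) (p : ℕ) :
    ∃ m, tailSum N p / 2 ≤ ∑ i ∈ Finset.range m, 1 / nuq N (p + i) := by
  have h := (summable_inv_nuq_add hnq p).hasSum.tendsto_sum_nat
  have hlt : tailSum N p / 2 < tailSum N p := half_lt_self (tailSum_pos hN hnq p)
  obtain ⟨m, hm⟩ := (h.eventually (lt_mem_nhds hlt)).exists
  exact ⟨m, hm.le⟩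

lemma Lseq_le (N : ℕ → ℝ) (s : ℕ) {p j : ℕ} (hj : j < p) :
    Lseq N s p ≤ (s : ℝ) ^ p * ((p / tailSum N p) ^ (p - j) * N j) := by
  have hp : p ≠ 0 := by omega
  rw [Lseq, if_neg hp]
  gcongr
  exact ciInf_le (Set.finite_range _).bddBelow (⟨j, hj⟩ : Fin p)

lemma exists_Lseq_eq (N : ℕ → ℝ) (s : ℕ) {p : ℕ} (hp : 1 ≤ p) :
    ∃ j < p, Lseq N s p = (s : ℝ) ^ p * ((p / tailSum N p) ^ (p - j) * N j) := by
  have : Nonempty (Fin p) := ⟨⟨0, hp⟩⟩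
  obtain ⟨j, hj⟩ := exists_eq_ciInf_of_finite
    (f := fun j : Fin p => ((p : ℝ) / tailSum N p) ^ (p - (j : ℕ)) * N j)
  exact ⟨j, j.2, by rw [Lseq, if_neg (by omega), ← hj]⟩

lemma Lseq_pos (hN : IsLC N) (hnq : NQA N) {s : ℕ} (hs : 1 ≤ s) (p : ℕ) : 0 < Lseq N s p := by
  rcases Nat.eq_zero_or_pos p with rfl | hp
  · simp [Lseq]
  · obtain ⟨j, -, h⟩ := exists_Lseq_eq N s hp
    have := hN.1 j
    have := tailSum_pos hN hnq p
    have : (0 : ℝ) < p := by exact_mod_cast hp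
    have : (0 : ℝ) < s := by exact_mod_cast hs
    rw [h]
    positivity

lemma Lseq_preceq (hN : IsLC N) (hnq : NQA N) {s : ℕ} (hs : 1 ≤ s) : Preceq (Lseq N s) N := by
  refine ⟨2 * s, fun p hp => ?_⟩
  have hs0 : (0 : ℝ) ≤ s := by positivity
  have hT := tailSum_pos hN hnq p
  have hp0 : (0 : ℝ) < p := by exact_mod_cast hp
  have hle : Lseq N s p / N p ≤ (2 * s : ℝ) ^ p := by
    rw [div_le_iff₀ (hN.1 p), mul_pow]
    obtain ⟨q, rfl⟩ : ∃ q, p = q + 1 := ⟨p - 1, by omega⟩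
    have h1 := Lseq_le N s (Nat.lt_succ_self q)
    have h2 : 1 / nuq N (q + 1) ≤ tailSum N (q + 1) := by
      simpa using sum_inv_nuq_le_tailSum hN hnq (q + 1) 1
    have h3 : ((q + 1 : ℕ) : ℝ) / tailSum N (q + 1) ≤ (q + 1 : ℕ) * nuq N (q + 1) := by
      rw [div_le_iff₀ hT, mul_assoc]
      have : 1 ≤ nuq N (q + 1) * tailSum N (q + 1) := by
        rw [div_le_iff₀ (nuq_pos hN _)] at h2
        linarith
      nlinarith
    have h4 : ((q + 1 : ℕ) : ℝ) ≤ 2 ^ (q + 1) := by exact_mod_cast (Nat.lt_two_pow_self).le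
    rw [show q + 1 - q = 1 by omega, pow_one] at h1
    calc Lseq N s (q + 1) ≤ s ^ (q + 1) * (((q + 1 : ℕ) : ℝ) / tailSum N (q + 1) * N q) := h1
      _ ≤ s ^ (q + 1) * ((2 ^ (q + 1) * nuq N (q + 1)) * N q) := by
        have := (hN.1 q).le
        have := (nuq_pos hN (q + 1)).le
        gcongr
        exact h3.trans (by gcongr)
      _ = 2 ^ (q + 1) * s ^ (q + 1) * N (q + 1) := by rw [← nuq_succ_mul hN q]; ring
  calc (Lseq N s p / N p) ^ ((1 : ℝ) / p) ≤ ((2 * s : ℝ) ^ p) ^ ((1 : ℝ) / p) := by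
        have := Lseq_pos hN hnq hs p
        have := hN.1 p
        gcongr
    _ = 2 * s := by
        rw [one_div, Real.pow_rpow_inv_natCast (by positivity) (by omega)]

lemma eventually_mul_le_nuq (hN : IsLC N) (hnq : NQA N) (A : ℝ) :
    ∀ᶠ n : ℕ in atTop, A * n ≤ nuq N n := by
  have hA : 0 < 1 / (2 * (|A| + 1)) := by positivity
  obtain ⟨k, hk⟩ := ((tendsto_tailSum N).eventually (gt_mem_nhds hA)).exists
  filter_upwards [eventually_ge_atTop (2 * k)] with n hn
  have hsum : ((n - k + 1 : ℕ) : ℝ) * (1 / nuq N n) ≤ tailSum N k := by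
    refine le_trans ?_ (sum_inv_nuq_le_tailSum hN hnq k (n - k + 1))
    have h := Finset.card_nsmul_le_sum (Finset.range (n - k + 1))
      (fun i => 1 / nuq N (k + i)) (1 / nuq N n) ?_
    · simpa only [nsmul_eq_mul, Finset.card_range] using h
    intro i hi
    have : k + i ≤ n := by have := Finset.mem_range.1 hi; omega
    exact one_div_le_one_div_of_le (nuq_pos hN _) (nuq_monotone hN this)
  have hcast : (n : ℝ) / 2 ≤ ((n - k + 1 : ℕ) : ℝ) := by
    rw [div_le_iff₀ two_pos]
    exact_mod_cast (by omega : n ≤ (n - k + 1) * 2)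
  have hν := nuq_pos hN n
  have h1 : (n : ℝ) / 2 * (1 / nuq N n) < 1 / (2 * (|A| + 1)) :=
    lt_of_le_of_lt (le_trans (by gcongr) hsum) hk
  rw [mul_one_div, div_div, div_lt_div_iff₀ (by positivity) (by positivity)] at h1
  have h2 : A * n ≤ |A| * n := by gcongr; exact le_abs_self A
  have : (0 : ℝ) ≤ n := by positivity
  nlinarith

lemma exists_factorial_le_weight (hN : IsLC N) (hnq : NQA N) {A : ℝ} (hA : 1 ≤ A) :
    ∃ c > 0, ∀ j : ℕ, c * A ^ j * (j.factorial : ℝ) ≤ N j := by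
  obtain ⟨k, hk⟩ := eventually_atTop.1 (eventually_mul_le_nuq hN hnq A)
  have hA0 : 0 < A := by linarith
  refine ⟨1 / (A ^ k * k.factorial), by positivity, fun j => ?_⟩
  rcases le_total j k with hjk | hkj
  · refine le_trans ?_ (one_le_weight hN j)
    rw [mul_assoc, one_div, ← div_eq_inv_mul, div_le_one (by positivity)]
    gcongr
  · induction j, hkj using Nat.le_induction with
    | base =>
      refine le_trans (le_of_eq ?_) (one_le_weight hN k)
      field_simp
    | succ j hj ih =>
      have h1 := hk (j + 1) (by omega)
      rw [← nuq_succ_mul hN j, Nat.factorial_succ]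
      calc 1 / (A ^ k * k.factorial) * A ^ (j + 1) * ((j + 1) * j.factorial : ℕ)
          = (A * (j + 1 : ℕ)) * (1 / (A ^ k * k.factorial) * A ^ j * j.factorial) := by
            push_cast; ring
        _ ≤ nuq N (j + 1) * N j := by
            have := (nuq_pos hN (j + 1)).le
            gcongr

lemma factorial_le_pow_mul_factorial {p j : ℕ} (hj : j ≤ p) :
    p.factorial ≤ p ^ (p - j) * j.factorial := by
  have h := Nat.factorial_mul_descFactorial (Nat.sub_le p j)
  rw [Nat.sub_sub_self hj] at h
  rw [← h, mul_comm]
  exact Nat.mul_le_mul_right _ (Nat.descFactorial_le_pow _ _)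

lemma Lseq_root_tendsto (hN : IsLC N) (hnq : NQA N) {s : ℕ} (hs : 1 ≤ s) :
    Tendsto (fun p : ℕ => (Lseq N s p / (p.factorial : ℝ)) ^ ((1 : ℝ) / p)) atTop atTop := by
  refine tendsto_atTop.2 fun A₀ => ?_
  set A := |A₀| + 1
  have hA : 1 ≤ A := by simp [A]
  have hA0 : 0 < A := by linarith
  obtain ⟨c, hc, hcN⟩ := exists_factorial_le_weight hN hnq (A := 2 * A) (by linarith)
  have hlim : ∀ᶠ p : ℕ in atTop, 1 / c ≤ (2 : ℝ) ^ p :=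
    (tendsto_pow_atTop_atTop_of_one_lt one_lt_two).eventually_ge_atTop _
  filter_upwards [hlim, eventually_ge_atTop 1,
    (tendsto_tailSum N).eventually (gt_mem_nhds (show 0 < 1 / (2 * A) by positivity))]
    with p h2 hp hT
  have hTp := tailSum_pos hN hnq p
  have hp0 : (0 : ℝ) < p := by exact_mod_cast hp
  suffices h : A ^ p ≤ Lseq N s p / p.factorial by
    calc A₀ ≤ A := (le_abs_self _).trans (by simp [A])
      _ = (A ^ p) ^ ((1 : ℝ) / p) := by
        rw [one_div, Real.pow_rpow_inv_natCast hA0.le (by omega)]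
      _ ≤ _ := by gcongr
  obtain ⟨j, hj, hL⟩ := exists_Lseq_eq N s hp
  rw [le_div_iff₀ (by positivity), hL]
  have hs1 : (1 : ℝ) ≤ s ^ p := one_le_pow₀ (by exact_mod_cast hs)
  have hX : 2 * A * p ≤ p / tailSum N p := by
    rw [le_div_iff₀ hTp]
    rw [lt_div_iff₀ (by positivity)] at hT
    nlinarith
  have hfac : (p.factorial : ℝ) ≤ p ^ (p - j) * j.factorial := by
    exact_mod_cast factorial_le_pow_mul_factorial hj.le
  have hc2 : 1 ≤ c * 2 ^ p := by
    rw [div_le_iff₀ hc] at h2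
    linarith
  have hN0 := hN.1 j
  calc A ^ p * p.factorial ≤ (c * 2 ^ p) * (A ^ p * (p ^ (p - j) * j.factorial)) := by
        refine le_trans (by gcongr) (le_mul_of_one_le_left (by positivity) hc2)
    _ = (2 * A * p) ^ (p - j) * (c * (2 * A) ^ j * j.factorial) := by
        have : (2 * A) ^ p = (2 * A) ^ (p - j) * (2 * A) ^ j := by
          rw [← pow_add, Nat.sub_add_cancel hj.le]
        rw [mul_pow _ (p : ℝ)]
        calc _ = (2 * A) ^ p * (c * (p ^ (p - j) * j.factorial)) := by rw [mul_pow]; ring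
          _ = _ := by rw [this]; ring
    _ ≤ (p / tailSum N p) ^ (p - j) * N j := by gcongr; exact hcN j
    _ ≤ _ := le_mul_of_one_le_left (by positivity) hs1

end WeightSequence

section Bang

/-- One step of Bang's argument: smallness of the derivatives of order `< k` at `x` propagates to
the right at exponential rate `4 * μ`, given the a priori bound on the derivative of order `k`. -/
lemma bang_growth {g : ℕ → ℝ → ℂ} (hg : ∀ n x, HasDerivAt (g n) (g (n + 1) x) x) {W : ℕ → ℝ}
    (hW : ∀ n, 0 < W n) {k : ℕ} {μ x y : ℝ} (hμ : 0 ≤ μ)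
    (hWμ : ∀ n < k, W (n + 1) ≤ μ * W n)
    (hk : ∀ z ∈ Set.Icc x y, ‖g k z‖ ≤ W k)
    (hx : ∀ n < k, ‖g n x‖ ≤ 4 ^ n / 4 ^ k * W n) {n : ℕ} (hn : n ≤ k) :
    ∀ z ∈ Set.Icc x y, ‖g n z‖ ≤ 4 ^ n / 4 ^ k * W n * Real.exp (4 * μ * (z - x)) := by
  induction hn using Nat.decreasingInduction with
  | self =>
    intro z hz
    have h1 : 1 ≤ Real.exp (4 * μ * (z - x)) :=
      Real.one_le_exp (mul_nonneg (by positivity) (sub_nonneg.2 hz.1))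
    rw [div_self (by positivity), one_mul]
    exact (hk z hz).trans (le_mul_of_one_le_right (hW k).le h1)
  | of_succ n hn ih =>
    have hB : ∀ z, HasDerivAt (fun z => 4 ^ n / 4 ^ k * W n * Real.exp (4 * μ * (z - x)))
        (4 ^ n / 4 ^ k * W n * (Real.exp (4 * μ * (z - x)) * (4 * μ * 1))) z := fun z =>
      (((hasDerivAt_id z).sub_const x).const_mul (4 * μ)).exp.const_mul _
    refine image_norm_le_of_norm_deriv_right_le_deriv_boundary
      (f' := g (n + 1)) (fun z _ => (hg n z).continuousAt.continuousWithinAt)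
      (fun z _ => (hg n z).hasDerivWithinAt) (by simpa using hx n hn) hB fun z hz => ?_
    refine (ih z (Set.Ico_subset_Icc_self hz)).trans ?_
    calc 4 ^ (n + 1) / 4 ^ k * W (n + 1) * Real.exp (4 * μ * (z - x))
        ≤ 4 ^ (n + 1) / 4 ^ k * (μ * W n) * Real.exp (4 * μ * (z - x)) := by
          gcongr; exact hWμ n hn
      _ = _ := by rw [pow_succ]; ring

/-- Bang's estimate: a function which is flat at `0` up to order `q` stays small on an interval
whose length is comparable to the sum of the first `q` reciprocal quotients of the bounds. -/
lemma bang_estimate {g : ℕ → ℝ → ℂ} (hg : ∀ n x, HasDerivAt (g n) (g (n + 1) x) x) {W : ℕ → ℝ}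
    (hW : ∀ n, 0 < W n) {μ : ℕ → ℝ} (hμ : ∀ n, 0 < μ n) (hμm : Monotone μ)
    (hWμ : ∀ n, W (n + 1) = μ n * W n) {q : ℕ} (hq : 1 ≤ q) {b : ℝ} (hb : 0 ≤ b)
    (hbd : ∀ n ≤ q, ∀ z ∈ Set.Icc 0 b, ‖g n z‖ ≤ W n) (h0 : ∀ n < q, g n 0 = 0)
    (hbq : b ≤ ∑ i ∈ Finset.range q, 1 / (8 * μ i)) : ‖g 0 b‖ ≤ W 0 / 2 := by
  have key : ∀ k ≤ q, ∀ x ∈ Set.Icc 0 b, x ≤ ∑ i ∈ Finset.Ico k q, 1 / (8 * μ i) →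
      ∀ n ≤ k, n < q → ‖g n x‖ ≤ 4 ^ n / 4 ^ k * W n / 2 := by
    intro k hk
    induction hk using Nat.decreasingInduction with
    | self =>
      intro x hx hxs n _ hn
      obtain rfl : x = 0 := le_antisymm (by simpa using hxs) hx.1
      rw [h0 n hn, norm_zero]
      have := hW n
      positivity
    | of_succ k hk ih =>
      intro x hx hxs n hn _
      rw [Finset.sum_eq_sum_Ico_succ_bot hk] at hxs
      have hμk := hμ k
      have hstep : 0 < 1 / (8 * μ k) := by positivity
      have hx' : max 0 (x - 1 / (8 * μ k)) ∈ Set.Icc 0 b :=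
        ⟨le_max_left _ _, max_le hb (by linarith [hx.2])⟩
      have hsum : max 0 (x - 1 / (8 * μ k)) ≤ ∑ i ∈ Finset.Ico (k + 1) q, 1 / (8 * μ i) :=
        max_le (Finset.sum_nonneg fun i _ => by have := hμ i; positivity) (by linarith)
      have hle : max 0 (x - 1 / (8 * μ k)) ≤ x := max_le hx.1 (by linarith)
      have := bang_growth hg hW (k := k + 1) hμk.le
        (fun n hn => by
          rw [hWμ]
          exact mul_le_mul_of_nonneg_right (hμm (by omega)) (hW n).le)
        (fun z hz => hbd _ hk z ⟨hx'.1.trans hz.1, hz.2.trans hx.2⟩)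
        (fun n hn => (ih _ hx' hsum n hn.le (by omega)).trans
          (half_le_self (by have := hW n; positivity)))
        (n := n) (by omega) x ⟨hle, le_rfl⟩
      refine this.trans ?_
      have hexp : Real.exp (4 * μ k * (x - max 0 (x - 1 / (8 * μ k)))) ≤ 2 := by
        have h1 : x - max 0 (x - 1 / (8 * μ k)) ≤ 1 / (8 * μ k) := by
          linarith [le_max_right 0 (x - 1 / (8 * μ k))]
        have h2 : 4 * μ k * (x - max 0 (x - 1 / (8 * μ k))) ≤ 1 / 2 := by
          calc _ ≤ 4 * μ k * (1 / (8 * μ k)) := by gcongr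
            _ = 1 / 2 := by field_simp; norm_num
        have h3 : (1 / 2 : ℝ) ≤ Real.log 2 := by linarith [Real.log_two_gt_d9]
        calc _ ≤ Real.exp (Real.log 2) := Real.exp_le_exp.2 (h2.trans h3)
          _ = 2 := Real.exp_log two_pos
      have hWn := hW n
      calc _ ≤ 4 ^ n / 4 ^ (k + 1) * W n * 2 := by gcongr
        _ = _ := by rw [pow_succ (4 : ℝ) k]; field_simp; norm_num
  have := key 0 (by omega) b ⟨hb, le_rfl⟩ (by simpa using hbq) 0 le_rfl (by omega)
  simpa using this

/-- The `n`-th derivative of `x ^ m / m!`. -/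
noncomputable def monoDeriv (m n : ℕ) (x : ℝ) : ℝ :=
  if n ≤ m then x ^ (m - n) / ((m - n).factorial : ℝ) else 0

lemma hasDerivAt_monoDeriv (m n : ℕ) (x : ℝ) :
    HasDerivAt (monoDeriv m n) (monoDeriv m (n + 1) x) x := by
  unfold monoDeriv
  rcases lt_trichotomy n m with h | rfl | h
  · simp only [h.le, if_true, Nat.succ_le_of_lt h]
    obtain ⟨d, rfl⟩ : ∃ d, m = n + 1 + d := ⟨m - (n + 1), by omega⟩
    have e1 : n + 1 + d - n = d + 1 := by omega
    have e2 : n + 1 + d - (n + 1) = d := by omega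
    rw [e1, e2]
    refine ((hasDerivAt_pow (d + 1) x).div_const ((d + 1).factorial : ℝ)).congr_deriv ?_
    rw [Nat.factorial_succ]
    push_cast
    field_simp
  · simpa using hasDerivAt_const x (1 : ℝ)
  · simpa [not_le.2 h, show ¬ n + 1 ≤ m by omega] using hasDerivAt_const x (0 : ℝ)

lemma monoDeriv_zero (m n : ℕ) : monoDeriv m n 0 = if n = m then 1 else 0 := by
  unfold monoDeriv
  rcases lt_trichotomy n m with h | rfl | h
  · simp [h.le, h.ne, show m - n ≠ 0 by omega]
  · simp
  · simp [not_le.2 h, h.ne']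

lemma monoDeriv_nonneg (m n : ℕ) {x : ℝ} (hx : 0 ≤ x) : 0 ≤ monoDeriv m n x := by
  unfold monoDeriv
  split_ifs <;> positivity

lemma monoDeriv_le (m n : ℕ) {x R : ℝ} (hx : 0 ≤ x) (hxR : x ≤ R) :
    monoDeriv m n x ≤ (1 + R) ^ m := by
  unfold monoDeriv
  split_ifs
  · calc x ^ (m - n) / ((m - n).factorial : ℝ) ≤ x ^ (m - n) :=
          div_le_self (by positivity)
            (by exact_mod_cast Nat.one_le_iff_ne_zero.2 (Nat.factorial_ne_zero _))
      _ ≤ (1 + R) ^ (m - n) := by gcongr; linarith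
      _ ≤ (1 + R) ^ m := pow_le_pow_right₀ (by linarith) (Nat.sub_le _ _)
  · exact pow_nonneg (by linarith) m

/-- If `F 0` has exactly one nonzero derivative at `0` up to order `q`, namely the `p`-th one, and
its derivatives are bounded by `K * N n`, then `F 0` has to follow its Taylor monomial on an
interval of length comparable to `∑ 1 / ν`. -/
lemma monomial_bound {N : ℕ → ℝ} (hN : IsLC N) {F : ℕ → ℝ → ℂ}
    (hF : ∀ n x, HasDerivAt (F n) (F (n + 1) x) x) {p m : ℕ} (hm : 1 ≤ m) {K A R : ℝ} (hK : 0 < K)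
    (hA : 0 < A) (hR : ∑ i ∈ Finset.range m, 1 / (8 * nuq N (p + i)) ≤ R)
    (hbd : ∀ n, ∀ x ∈ Set.Icc 0 R, ‖F n x‖ ≤ K * N n)
    (h0 : ∀ n < p + m, F n 0 = if n = p then (A : ℂ) else 0) {k : ℕ} (hk : k < p) :
    A * ((∑ i ∈ Finset.range m, 1 / (8 * nuq N (p + i))) ^ (p - k) / ((p - k).factorial : ℝ))
      ≤ 4 * K * N k := by
  set T := ∑ i ∈ Finset.range m, 1 / (8 * nuq N (p + i)) with hT
  have hT0 : 0 ≤ T := Finset.sum_nonneg fun i _ => by have := nuq_pos hN (p + i); positivity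
  by_contra! hcon
  let c : ℕ → ℝ := fun k => (4 * K * N k * (p - k).factorial / A) ^ ((1 : ℝ) / ((p - k : ℕ) : ℝ))
  have hc0 : ∀ k, 0 < c k := fun k => by
    have := hN.1 k
    positivity
  have hcpow : ∀ k < p, A * (c k ^ (p - k) / ((p - k).factorial : ℝ)) = 4 * K * N k := by
    intro k hk
    have hNk := hN.1 k
    simp only [c, one_div]
    rw [Real.rpow_inv_natCast_pow (by positivity) (by omega)]
    field_simp
  obtain ⟨j, hj, hmin⟩ := Finset.exists_min_image (Finset.range p) c ⟨k, Finset.mem_range.2 hk⟩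
  rw [Finset.mem_range] at hj
  set b := c j with hbdef
  have hb0 : 0 < b := hc0 j
  have hble : ∀ n < p, ∀ x ∈ Set.Icc 0 b, A * monoDeriv p n x ≤ 4 * K * N n := by
    intro n hn x hx
    rw [← hcpow n hn, monoDeriv, if_pos hn.le]
    have : x ≤ c n := hx.2.trans (hmin n (Finset.mem_range.2 hn))
    have := hx.1
    gcongr
  have hbT : b ≤ T := by
    refine (hmin k (Finset.mem_range.2 hk)).trans ?_
    by_contra! h
    rw [← hcpow k hk] at hcon
    refine absurd hcon (not_lt.2 ?_)
    gcongr
  have hAN : A ≤ K * N p := by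
    have h := hbd p 0 ⟨le_rfl, hT0.trans hR⟩
    rw [h0 p (by omega), if_pos rfl] at h
    simpa [abs_of_pos hA] using h
  let g : ℕ → ℝ → ℂ := fun n x => F (j + n) x - ((A * monoDeriv p (j + n) x : ℝ) : ℂ)
  have hg : ∀ n x, HasDerivAt (g n) (g (n + 1) x) x := fun n x =>
    (hF (j + n) x).sub ((hasDerivAt_monoDeriv p (j + n) x).const_mul A).ofReal_comp
  have hmono : ∀ n, ∀ x ∈ Set.Icc 0 b, A * monoDeriv p n x ≤ 4 * K * N n := by
    intro n x hx
    have hKN : 0 < K * N n := mul_pos hK (hN.1 n)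
    rcases lt_trichotomy n p with h | rfl | h
    · exact hble n h x hx
    · simp only [monoDeriv, le_refl, if_true, Nat.sub_self, pow_zero, Nat.factorial_zero]
      norm_num
      linarith
    · rw [monoDeriv, if_neg (by omega), mul_zero]
      linarith
  have hnormmono : ∀ n, ∀ x ∈ Set.Icc 0 b,
      ‖((A * monoDeriv p n x : ℝ) : ℂ)‖ = A * monoDeriv p n x := fun n x hx => by
    rw [Complex.norm_real, Real.norm_of_nonneg (mul_nonneg hA.le (monoDeriv_nonneg _ _ hx.1))]
  have hest := bang_estimate hg (W := fun n => 5 * K * N (j + n)) (μ := fun n => nuq N (j + 1 + n))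
    (fun n => mul_pos (by positivity) (hN.1 _)) (fun n => nuq_pos hN _)
    (fun a b hab => nuq_monotone hN (by omega))
    (fun n => by
      have h := nuq_succ_mul hN (j + n)
      show 5 * K * N (j + n + 1) = nuq N (j + 1 + n) * (5 * K * N (j + n))
      rw [show j + 1 + n = j + n + 1 by ring, ← h]; ring)
    (q := p + m - (j + 1)) (by omega) hb0.le
    (fun n _ z hz => by
      refine (norm_sub_le _ _).trans ?_
      rw [hnormmono _ _ hz]
      have h1 := hbd (j + n) z ⟨hz.1, hz.2.trans (hbT.trans hR)⟩
      have h2 := hmono (j + n) z hz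
      show _ ≤ 5 * K * N (j + n)
      linarith)
    (fun n hn => by
      simp only [g]
      rw [h0 _ (by omega), monoDeriv_zero]
      split_ifs <;> simp)
    (by
      refine hbT.trans ?_
      rw [hT]
      have e : p + m - (j + 1) = (p - (j + 1)) + m := by omega
      rw [e, Finset.sum_range_add]
      have e2 : ∀ i, j + 1 + (p - (j + 1) + i) = p + i := fun i => by omega
      simp only [e2]
      refine le_add_of_nonneg_left (Finset.sum_nonneg fun i _ => ?_)
      have := nuq_pos hN (j + 1 + i)
      positivity)
  have hlow : A * monoDeriv p j b = 4 * K * N j := by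
    rw [monoDeriv, if_pos hj.le, hcpow j hj]
  have hbb : b ∈ Set.Icc 0 b := ⟨hb0.le, le_rfl⟩
  have h1 := hbd j b ⟨hb0.le, hbT.trans hR⟩
  have h2 : ‖((A * monoDeriv p j b : ℝ) : ℂ)‖ ≤ ‖F j b‖ + ‖g 0 b‖ := by
    have : ((A * monoDeriv p j b : ℝ) : ℂ) = F j b - g 0 b := by simp [g]
    rw [this]
    exact norm_sub_le _ _
  rw [hnormmono _ _ hbb, hlow] at h2
  have h3 : ‖g 0 b‖ ≤ 5 * K * N j / 2 := hest
  have : 0 < K * N j := mul_pos hK (hN.1 j)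
  linarith

end Bang

section Necessity

variable {N M : ℕ → ℝ}

/-- Quantitative failure of `Preceq M (Lseq N s)` at arbitrarily large indices. -/
lemma exists_large_of_not_preceq (hN : IsLC N) (hnq : NQA N) {s : ℕ} (hs : 1 ≤ s)
    (hM : ∀ p, 0 < M p) (h : ¬ Preceq M (Lseq N s)) {B : ℝ} (hB : 0 ≤ B) (P : ℕ) :
    ∃ p, P < p ∧ ∃ k < p, B ^ p * ((p / tailSum N p) ^ (p - k) * N k) < M p := by
  have hnn : ∀ p : ℕ, 0 ≤ (M p / Lseq N s p) ^ ((1 : ℝ) / p) := fun p =>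
    Real.rpow_nonneg (div_pos (hM p) (Lseq_pos hN hnq hs p)).le _
  simp only [Preceq, not_exists, not_forall, not_le] at h
  obtain ⟨p, hp, hlt⟩ := h
    (B + ∑ p ∈ Finset.range (P + 1), (M p / Lseq N s p) ^ ((1 : ℝ) / p))
  have hsum0 := Finset.sum_nonneg fun p (_ : p ∈ Finset.range (P + 1)) => hnn p
  refine ⟨p, ?_, ?_⟩
  · by_contra! hpP
    have := Finset.single_le_sum (fun p _ => hnn p) (Finset.mem_range.2 (Nat.lt_succ_of_le hpP))
    linarith
  · obtain ⟨k, hk, hL⟩ := exists_Lseq_eq N s hp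
    refine ⟨k, hk, ?_⟩
    have hL0 := Lseq_pos hN hnq hs p
    have h1 : B ^ p < M p / Lseq N s p := by
      have hBlt : B < (M p / Lseq N s p) ^ ((1 : ℝ) / p) := by linarith
      calc B ^ p < ((M p / Lseq N s p) ^ ((1 : ℝ) / p)) ^ p :=
            pow_lt_pow_left₀ hBlt hB (by omega)
        _ = _ := by
            rw [one_div, Real.rpow_inv_natCast_pow (div_pos (hM p) hL0).le (by omega)]
    rw [lt_div_iff₀ hL0, hL] at h1
    refine lt_of_le_of_lt ?_ h1
    have hs1 : (1 : ℝ) ≤ s ^ p := one_le_pow₀ (by exact_mod_cast hs)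
    have := hN.1 k
    have := tailSum_pos hN hnq p
    exact mul_le_mul_of_nonneg_left (le_mul_of_one_le_left (by positivity) hs1) (by positivity)

lemma hasDerivAt_iteratedDeriv {f : ℝ → ℂ} (hf : ContDiff ℝ (⊤ : ℕ∞) f) (n : ℕ) (x : ℝ) :
    HasDerivAt (iteratedDeriv n f) (iteratedDeriv (n + 1) f x) x := by
  rw [iteratedDeriv_succ]
  exact (hf.differentiable_iteratedDeriv n (by exact_mod_cast WithTop.coe_lt_top n) x).hasDerivAt

/-- The lacunary sequence supported on the points `π (P n)`, with weights
`(P n + 1) ^ (-m) * M m`. -/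
noncomputable def lacunary (M : ℕ → ℝ) (P : ℕ → ℕ) (π : ℕ → ℕ) (m : ℕ) : ℝ :=
  open Classical in if h : ∃ n, π (P n) = m then M m / (P h.choose + 1) ^ m else 0

section Lacunary

variable {P π : ℕ → ℕ}

lemma lacunary_apply (M : ℕ → ℝ) (hinj : Function.Injective fun n => π (P n)) (n : ℕ) :
    lacunary M P π (π (P n)) = M (π (P n)) / (P n + 1) ^ π (P n) := by
  have h : ∃ i, π (P i) = π (P n) := ⟨n, rfl⟩
  rw [lacunary, dif_pos h, hinj h.choose_spec]

lemma lacunary_eq_zero (M : ℕ → ℝ) {m : ℕ} (hm : ∀ n, π (P n) ≠ m) : lacunary M P π m = 0 := by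
  rw [lacunary, dif_neg]
  push Not
  exact hm

lemma lacunary_nonneg (hM : ∀ p, 0 < M p) (m : ℕ) : 0 ≤ lacunary M P π m := by
  have := hM m
  unfold lacunary
  split_ifs <;> positivity

lemma lacunary_le (hM : ∀ p, 0 < M p) (m : ℕ) : lacunary M P π m ≤ M m := by
  have := hM m
  unfold lacunary
  split_ifs
  · exact div_le_self this.le (one_le_pow₀ (by simp))
  · exact this.le

lemma lacunary_mem_lambdaBeurling (hM : ∀ p, 0 < M p) (hP : StrictMono P)
    (hπ : ∀ n, P n < π (P n)) (hπ' : ∀ n, π (P n) < P (n + 1)) :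
    (fun m => (lacunary M P π m : ℂ)) ∈ LambdaBeurling M := by
  have hmono : StrictMono fun n => π (P n) :=
    strictMono_nat_of_lt_succ fun n => (hπ' n).trans (hπ (n + 1))
  intro h hh
  obtain ⟨n₀, hn₀⟩ := exists_nat_gt (1 / h)
  refine ⟨(1 + 1 / h) ^ P n₀, by positivity, fun m => ?_⟩
  have hMm := hM m
  have hC : (1 : ℝ) ≤ (1 + 1 / h) ^ P n₀ := one_le_pow₀ (by simp [hh.le])
  rw [Complex.norm_real, Real.norm_of_nonneg (lacunary_nonneg hM m)]
  by_cases hm : ∃ n, π (P n) = m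
  swap
  · rw [lacunary_eq_zero M (by simpa using hm)]
    positivity
  obtain ⟨n, rfl⟩ := hm
  rcases lt_or_ge n n₀ with hn | hn
  · refine (lacunary_le hM _).trans ?_
    refine le_mul_of_one_le_left hMm.le ?_
    have hle : π (P n) ≤ P n₀ := (hπ' n).le.trans (hP.monotone hn)
    calc (1 : ℝ) = (1 / h) ^ π (P n) * h ^ π (P n) := by
          rw [← mul_pow, one_div_mul_cancel hh.ne', one_pow]
      _ ≤ (1 + 1 / h) ^ P n₀ * h ^ π (P n) := by
          gcongr
          calc (1 / h) ^ π (P n) ≤ (1 + 1 / h) ^ π (P n) := by gcongr; linarith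
            _ ≤ _ := pow_le_pow_right₀ (by simp [hh.le]) hle
  · rw [lacunary_apply M hmono.injective, div_eq_mul_inv, mul_comm (M _), ← inv_pow]
    have hPn : 1 / h ≤ (P n : ℝ) + 1 := by
      have : (n₀ : ℝ) ≤ P n := by exact_mod_cast hn.trans (hP.id_le n)
      linarith
    have hinv : ((P n : ℝ) + 1)⁻¹ ≤ h := by
      rw [inv_le_comm₀ (by positivity) hh]
      simpa using hPn
    gcongr
    calc ((P n : ℝ) + 1)⁻¹ ^ π (P n) ≤ h ^ π (P n) := by gcongr
      _ ≤ _ := le_mul_of_one_le_left (by positivity) hC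

end Lacunary

/-- The estimate forced by a function whose Taylor coefficients at `0` have a gap around `p`. -/
lemma coefficient_bound (hN : IsLC N) (hnq : NQA N) (hM : ∀ p, 0 < M p) {f : ℝ → ℂ}
    (hf : ContDiff ℝ (⊤ : ℕ∞) f) {C : ℝ} (hC : 0 < C)
    (hfC : ∀ n x, ‖iteratedDeriv n f x‖ ≤ C * N n) {a : ℕ → ℝ} (ha0 : ∀ m, 0 ≤ a m)
    (haM : ∀ m, a m ≤ M m) (hfa : ∀ m, iteratedDeriv m f 0 = a m) {P p q : ℕ} (hPp : P < p)
    (hap : 0 < a p) (hgap : ∀ m, P ≤ m → m < p + q → m ≠ p → a m = 0)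
    (hq : tailSum N p / 2 ≤ ∑ i ∈ Finset.range q, 1 / nuq N (p + i)) {k : ℕ} (hk : k < p) :
    a p * (tailSum N p / (16 * p)) ^ (p - k)
      ≤ 4 * (C + ∑ m ∈ Finset.range P, M m * (1 + tailSum N 0) ^ m) * N k := by
  have hT := tailSum_pos hN hnq p
  have hq1 : 1 ≤ q := by
    by_contra! h
    obtain rfl : q = 0 := by omega
    simp only [Finset.range_zero, Finset.sum_empty] at hq
    linarith
  have hsum8 : ∑ i ∈ Finset.range q, 1 / (8 * nuq N (p + i))
      = (∑ i ∈ Finset.range q, 1 / nuq N (p + i)) / 8 := by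
    rw [Finset.sum_div]
    exact Finset.sum_congr rfl fun i _ => by rw [div_div, mul_comm]
  let F : ℕ → ℝ → ℂ := fun n x =>
    iteratedDeriv n f x - ∑ m ∈ Finset.range P, ((a m * monoDeriv m n x : ℝ) : ℂ)
  have hF : ∀ n x, HasDerivAt (F n) (F (n + 1) x) x := fun n x =>
    (hasDerivAt_iteratedDeriv hf n x).sub (HasDerivAt.fun_sum fun m _ =>
      ((hasDerivAt_monoDeriv m n x).const_mul (a m)).ofReal_comp)
  have hT0 := tailSum_pos hN hnq 0
  have hD : 0 ≤ ∑ m ∈ Finset.range P, M m * (1 + tailSum N 0) ^ m :=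
    Finset.sum_nonneg fun m _ => by have := hM m; positivity
  have hmain := monomial_bound hN hF hq1 (R := tailSum N 0)
    (K := C + ∑ m ∈ Finset.range P, M m * (1 + tailSum N 0) ^ m) (by linarith) hap
    (by
      rw [hsum8]
      have h1 := sum_inv_nuq_le_tailSum hN hnq p q
      have h2 := tailSum_antitone hN hnq (Nat.zero_le p)
      linarith)
    (fun n x hx => by
      refine (norm_sub_le _ _).trans ?_
      rw [add_mul]
      refine add_le_add (hfC n x) ((norm_sum_le _ _).trans ?_)
      refine le_trans (Finset.sum_le_sum fun m _ => ?_)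
        (le_mul_of_one_le_right hD (one_le_weight hN n))
      rw [Complex.norm_real, Real.norm_of_nonneg (mul_nonneg (ha0 m) (monoDeriv_nonneg _ _ hx.1))]
      exact mul_le_mul (haM m) (monoDeriv_le m n hx.1 hx.2) (monoDeriv_nonneg _ _ hx.1) (hM m).le)
    (fun n hn => by
      simp only [F, monoDeriv_zero, hfa, mul_ite, mul_one, mul_zero]
      rw [← Complex.ofReal_sum, Finset.sum_ite_eq]
      by_cases hnP : n < P
      · rw [if_pos (Finset.mem_range.2 hnP), if_neg (by omega), sub_self]
      · rw [if_neg (by simpa using hnP)]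
        by_cases hnp : n = p
        · simp [hnp]
        · simp [hnp, hgap n (not_lt.1 hnP) hn hnp])
    hk
  refine le_trans ?_ hmain
  have hp0 : (0 : ℝ) < p := by exact_mod_cast (by omega : 0 < p)
  have hfac : ((p - k).factorial : ℝ) ≤ p ^ (p - k) := by
    exact_mod_cast (Nat.factorial_le_pow _).trans (Nat.pow_le_pow_left (Nat.sub_le _ _) _)
  have h16 : tailSum N p / 16 ≤ ∑ i ∈ Finset.range q, 1 / (8 * nuq N (p + i)) := by
    rw [hsum8]
    linarith
  calc a p * (tailSum N p / (16 * p)) ^ (p - k)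
      = a p * ((tailSum N p / 16) ^ (p - k) / p ^ (p - k)) := by rw [← div_pow, div_div]
    _ ≤ _ := by
        have : 0 ≤ ∑ i ∈ Finset.range q, 1 / (8 * nuq N (p + i)) := by linarith
        gcongr

theorem preceq_of_subset (hN : IsLC N) (hnq : NQA N) {s : ℕ} (hs : 1 ≤ s) (hM : ∀ p, 0 < M p)
    (hsub : LambdaBeurling M ⊆ BorelMap '' DBeurling N) : Preceq M (Lseq N s) := by
  by_contra hcon
  let D : ℕ → ℝ := fun P => ∑ m ∈ Finset.range P, M m * (1 + tailSum N 0) ^ m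
  have hT0 := tailSum_pos hN hnq 0
  have hD : ∀ P, 0 ≤ D P := fun P =>
    Finset.sum_nonneg fun m _ => by have := hM m; positivity
  have hex : ∀ P : ℕ, ∃ p, P < p ∧ ∃ k < p,
      (16 * (P + 1) * (4 * (P + 1 + D P))) ^ p * ((p / tailSum N p) ^ (p - k) * N k) < M p :=
    fun P => exists_large_of_not_preceq hN hnq hs hM hcon
      (by have := hD P; positivity) P
  choose π hπ κ hκ hbig using hex
  choose q hq using exists_half_tailSum_le_sum hN hnq
  obtain ⟨P, hPsucc⟩ : ∃ P : ℕ → ℕ, ∀ n, P (n + 1) = π (P n) + q (π (P n)) + 1 :=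
    ⟨fun n => Nat.rec 0 (fun _ P => π P + q (π P) + 1) n, fun _ => rfl⟩
  have hπ' : ∀ n, π (P n) < P (n + 1) := fun n => by rw [hPsucc]; omega
  have hP : StrictMono P := strictMono_nat_of_lt_succ fun n => (hπ _).trans (hπ' n)
  have hinj : Function.Injective fun n => π (P n) :=
    (strictMono_nat_of_lt_succ fun n => (hπ' n).trans (hπ _)).injective
  obtain ⟨f, ⟨hf, -, hfb⟩, hfa⟩ := hsub (lacunary_mem_lambdaBeurling hM hP (fun n => hπ _) hπ')
  obtain ⟨C, hC, hfC⟩ := hfb 1 one_pos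
  obtain ⟨n, hn⟩ := exists_nat_ge C
  have hval := lacunary_apply M hinj n
  have hgap : ∀ m, P n ≤ m → m < π (P n) + q (π (P n)) → m ≠ π (P n) → lacunary M P π m = 0 := by
    intro m hm1 hm2 hm3
    refine lacunary_eq_zero M fun i hi => ?_
    rcases lt_trichotomy i n with hin | rfl | hin
    · have h1 := hπ' i
      have h2 := hP.monotone (Nat.succ_le_of_lt hin)
      simp only [Nat.succ_eq_add_one] at h2
      omega
    · exact hm3 hi.symm
    · have h1 := hπ (P i)
      have h2 := hP.monotone (Nat.succ_le_of_lt hin)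
      simp only [Nat.succ_eq_add_one] at h2
      have h3 := hPsucc n
      omega
  have hMp := hM (π (P n))
  have hbound := coefficient_bound hN hnq hM hf hC (fun n x => by simpa using hfC n x)
    (lacunary_nonneg hM) (lacunary_le hM) (fun m => congrFun hfa m) (hπ (P n))
    (by rw [hval]; positivity) hgap (hq _) (hκ (P n))
  have hbig' := hbig (P n)
  rw [hval] at hbound
  set p := π (P n)
  set k := κ (P n)
  have hp1 : p ≠ 0 := by have := hπ (P n); omega
  have hp0 : (0 : ℝ) < p := by exact_mod_cast Nat.pos_of_ne_zero hp1
  have hT := tailSum_pos hN hnq p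
  have hNk := hN.1 k
  have hDP := hD (P n)
  have hk : k < p := hκ (P n)
  set X := (p / tailSum N p) ^ (p - k) with hX
  have hX0 : 0 < X := by positivity
  have hY : (tailSum N p / (16 * p)) ^ (p - k) * (X * 16 ^ p) ≥ 1 := by
    have e : (tailSum N p / (16 * p)) ^ (p - k) * X = (1 / 16) ^ (p - k) := by
      rw [hX, ← mul_pow]
      congr 1
      field_simp
    rw [← mul_assoc, e, one_div, inv_pow, ← div_eq_inv_mul]
    exact (one_le_div (by positivity)).2 (pow_le_pow_right₀ (by norm_num) (Nat.sub_le _ _))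
  have hE1 : (1 : ℝ) ≤ 4 * (P n + 1 + D (P n)) := by
    have : (0 : ℝ) ≤ (P n : ℝ) := Nat.cast_nonneg _
    linarith
  have hE : 4 * (P n + 1 + D (P n)) ≤ (4 * (P n + 1 + D (P n))) ^ p :=
    le_self_pow₀ hE1 hp1
  have h1 : (16 * (P n + 1)) ^ p * (4 * (P n + 1 + D (P n))) * (X * N k) < M p := by
    refine lt_of_le_of_lt ?_ hbig'
    rw [mul_pow (16 * ((P n : ℝ) + 1))]
    gcongr
  have hCP : C ≤ P n := hn.trans (by exact_mod_cast hP.id_le n)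
  have h2 : 4 * (P n + 1 + D (P n)) * N k < 4 * (C + D (P n)) * N k := by
    have hY0 : 0 < (tailSum N p / (16 * p)) ^ (p - k) := by positivity
    calc 4 * (P n + 1 + D (P n)) * N k
        ≤ 4 * (P n + 1 + D (P n)) * N k * ((tailSum N p / (16 * p)) ^ (p - k) * (X * 16 ^ p)) :=
          le_mul_of_one_le_right (by positivity) hY
      _ = ((16 * (P n + 1)) ^ p * (4 * (P n + 1 + D (P n))) * (X * N k)) / (P n + 1) ^ p
          * (tailSum N p / (16 * p)) ^ (p - k) := by
          rw [mul_pow]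
          field_simp
      _ < M p / (P n + 1) ^ p * (tailSum N p / (16 * p)) ^ (p - k) := by gcongr
      _ ≤ _ := hbound
  have h3 := lt_of_mul_lt_mul_right h2 hNk.le
  linarith

end Necessity

section Bump

/-- The mean of `φ` over the interval of radius `w` around `x`. -/
noncomputable def avg (w : ℝ) (φ : ℝ → ℂ) (x : ℝ) : ℂ :=
  ((1 / (2 * w) : ℝ) : ℂ) * ∫ y in (x - w)..(x + w), φ y

lemma norm_avg_le {w : ℝ} (hw : 0 < w) {φ : ℝ → ℂ} {C x : ℝ}
    (h : ∀ y, ‖φ y‖ ≤ C) : ‖avg w φ x‖ ≤ C := by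
  have h1 : ‖∫ y in (x - w)..(x + w), φ y‖ ≤ C * |x + w - (x - w)| :=
    intervalIntegral.norm_integral_le_of_norm_le_const fun y _ => h y
  rw [show x + w - (x - w) = 2 * w by ring, abs_of_pos (by positivity)] at h1
  rw [avg, norm_mul, Complex.norm_real, Real.norm_of_nonneg (by positivity)]
  calc 1 / (2 * w) * ‖∫ y in (x - w)..(x + w), φ y‖ ≤ 1 / (2 * w) * (C * (2 * w)) := by gcongr
    _ = C := by field_simp

lemma avg_sub {w : ℝ} {φ ψ : ℝ → ℂ} (hφ : Continuous φ) (hψ : Continuous ψ) (x : ℝ) :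
    avg w φ x - avg w ψ x = avg w (fun y => φ y - ψ y) x := by
  rw [avg, avg, avg, intervalIntegral.integral_sub (hφ.intervalIntegrable _ _)
    (hψ.intervalIntegrable _ _), mul_sub]

lemma avg_eq_of_forall_eq {w : ℝ} (hw : 0 < w) {φ : ℝ → ℂ} {c : ℂ} {x : ℝ}
    (h : ∀ y, |y - x| ≤ w → φ y = c) : avg w φ x = c := by
  have h1 : ∫ y in (x - w)..(x + w), φ y = ∫ _ in (x - w)..(x + w), c := by
    refine intervalIntegral.integral_congr fun y hy => h y ?_
    rw [Set.uIcc_of_le (by linarith)] at hy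
    rw [abs_le]
    constructor <;> linarith [hy.1, hy.2]
  rw [avg, h1, intervalIntegral.integral_const, show x + w - (x - w) = 2 * w by ring,
    Complex.real_smul, ← mul_assoc, ← Complex.ofReal_mul, one_div_mul_cancel (by positivity)]
  simp

lemma hasDerivAt_avg {φ : ℝ → ℂ} (hφ : Continuous φ) (w x : ℝ) :
    HasDerivAt (avg w φ) (((1 / (2 * w) : ℝ) : ℂ) * (φ (x + w) - φ (x - w))) x := by
  have hprim : ∀ y, HasDerivAt (fun y => ∫ z in (0 : ℝ)..y, φ z) (φ y) y := fun y =>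
    intervalIntegral.integral_hasDerivAt_right (hφ.intervalIntegrable _ _)
      hφ.stronglyMeasurable.stronglyMeasurableAtFilter hφ.continuousAt
  have h1 : HasDerivAt (fun x => ∫ z in (0 : ℝ)..(x + w), φ z) (φ (x + w)) x :=
    (hprim (x + w)).comp_add_const x w
  have h2 : HasDerivAt (fun x => ∫ z in (0 : ℝ)..(x - w), φ z) (φ (x - w)) x :=
    (hprim (x - w)).comp_sub_const x w
  refine ((h1.sub h2).const_mul _).congr_of_eventuallyEq (Eventually.of_forall fun y => ?_)
  simp only [avg, Pi.sub_apply]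
  rw [intervalIntegral.integral_interval_sub_left (hφ.intervalIntegrable _ _)
    (hφ.intervalIntegrable _ _)]

lemma continuous_avg {φ : ℝ → ℂ} (hφ : Continuous φ) (w : ℝ) : Continuous (avg w φ) :=
  continuous_iff_continuousAt.2 fun x => (hasDerivAt_avg hφ w x).continuousAt

/-- `m`-fold iterated mean with radii `w k, …, w (k + m - 1)`. -/
noncomputable def iterAvg (w : ℕ → ℝ) (φ : ℝ → ℂ) : ℕ → ℕ → ℝ → ℂ
  | 0, _ => φ
  | m + 1, k => avg (w k) (iterAvg w φ m (k + 1))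

section IterAvg

variable {w : ℕ → ℝ} {φ : ℝ → ℂ}

lemma continuous_iterAvg (hφ : Continuous φ) (m k : ℕ) : Continuous (iterAvg w φ m k) := by
  induction m generalizing k with
  | zero => exact hφ
  | succ m ih => exact continuous_avg (ih _) _

lemma norm_iterAvg_le (hw : ∀ i, 0 < w i) {C : ℝ} (h : ∀ y, ‖φ y‖ ≤ C) (m k : ℕ) (x : ℝ) :
    ‖iterAvg w φ m k x‖ ≤ C := by
  induction m generalizing k x with
  | zero => exact h x
  | succ m ih => exact norm_avg_le (hw k) fun y => ih _ y

lemma iterAvg_eq_of_forall_eq (hw : ∀ i, 0 < w i) {c : ℂ} (m k : ℕ) {x : ℝ}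
    (h : ∀ y, |y - x| ≤ ∑ i ∈ Finset.range m, w (k + i) → φ y = c) : iterAvg w φ m k x = c := by
  induction m generalizing k x with
  | zero => exact h x (by simp)
  | succ m ih =>
    refine avg_eq_of_forall_eq (hw k) fun y hy => ih _ fun z hz => h z ?_
    rw [Finset.sum_range_succ']
    have e : ∑ i ∈ Finset.range m, w (k + (i + 1)) = ∑ i ∈ Finset.range m, w (k + 1 + i) :=
      Finset.sum_congr rfl fun i _ => congrArg w (by ring)
    rw [e, add_zero]
    calc |z - x| ≤ |z - y| + |y - x| := abs_sub_le _ _ _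
      _ ≤ _ := add_le_add hz hy

lemma avg_sub_self_norm_le (hφ : Continuous φ) {r c : ℝ} (hr : 0 < r)
    (hL : ∀ x y, ‖φ x - φ y‖ ≤ c * |x - y|) (hc : 0 ≤ c) (x : ℝ) :
    ‖avg r φ x - φ x‖ ≤ c * r := by
  have h1 : ‖∫ y in (x - r)..(x + r), (φ y - φ x)‖ ≤ c * r * |x + r - (x - r)| := by
    refine intervalIntegral.norm_integral_le_of_norm_le_const fun y hy => (hL y x).trans ?_
    rw [Set.uIoc_of_le (by linarith)] at hy
    gcongr
    rw [abs_le]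
    constructor <;> linarith [hy.1, hy.2]
  have h2 : avg r φ x - φ x
      = ((1 / (2 * r) : ℝ) : ℂ) * ∫ y in (x - r)..(x + r), (φ y - φ x) := by
    have hconst : avg r (fun _ => φ x) x = φ x := avg_eq_of_forall_eq hr fun _ _ => rfl
    calc avg r φ x - φ x = avg r φ x - avg r (fun _ => φ x) x := by rw [hconst]
      _ = _ := by rw [avg_sub hφ continuous_const, avg]
  rw [show x + r - (x - r) = 2 * r by ring, abs_of_pos (by positivity)] at h1
  rw [h2, norm_mul, Complex.norm_real, Real.norm_of_nonneg (by positivity)]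
  calc 1 / (2 * r) * ‖∫ y in (x - r)..(x + r), (φ y - φ x)‖
      ≤ 1 / (2 * r) * (c * r * (2 * r)) := by gcongr
    _ = c * r := by field_simp

lemma norm_iterAvg_succ_sub_le (hφ : Continuous φ) (hw : ∀ i, 0 < w i) {c : ℝ}
    (hL : ∀ x y, ‖φ x - φ y‖ ≤ c * |x - y|) (hc : 0 ≤ c) (m k : ℕ) (x : ℝ) :
    ‖iterAvg w φ (m + 1) k x - iterAvg w φ m k x‖ ≤ c * w (k + m) := by
  induction m generalizing k x with
  | zero => exact avg_sub_self_norm_le hφ (hw k) hL hc x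
  | succ m ih =>
    change ‖avg (w k) (iterAvg w φ (m + 1) (k + 1)) x - avg (w k) (iterAvg w φ m (k + 1)) x‖ ≤ _
    rw [avg_sub (continuous_iterAvg hφ _ _) (continuous_iterAvg hφ _ _)]
    refine norm_avg_le (hw k) fun y => ?_
    rw [show k + (m + 1) = k + 1 + m by ring]
    exact ih _ y

/-- The infinite iterated means form a family closed under averaging. -/
lemma exists_limit_iterAvg (hφ : Continuous φ) (hw : ∀ i, 0 < w i) (hs : Summable w) {c : ℝ}
    (hL : ∀ x y, ‖φ x - φ y‖ ≤ c * |x - y|) (hc : 0 ≤ c) :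
    ∃ F : ℕ → ℝ → ℂ, (∀ k, Continuous (F k)) ∧ (∀ k, F k = avg (w k) (F (k + 1))) ∧
      ∀ k x, Tendsto (fun m => iterAvg w φ m k x) atTop (nhds (F k x)) := by
  have hsk : ∀ k, Summable fun m => c * w (k + m) := fun k => by
    simpa only [add_comm] using ((summable_nat_add_iff k).2 hs).mul_left c
  have hdist : ∀ k x m, dist (iterAvg w φ m k x) (iterAvg w φ (m + 1) k x) ≤ c * w (k + m) :=
    fun k x m => by
      rw [dist_comm, dist_eq_norm]
      exact norm_iterAvg_succ_sub_le hφ hw hL hc m k x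
  have hlim : ∀ k x, ∃ a, Tendsto (fun m => iterAvg w φ m k x) atTop (nhds a) := fun k x =>
    cauchySeq_tendsto_of_complete (cauchySeq_of_dist_le_of_summable _ (hdist k x) (hsk k))
  choose F hF using hlim
  have htail : ∀ k, Tendsto (fun m => ∑' i, c * w (k + (m + i))) atTop (nhds 0) := fun k => by
    have h := tendsto_sum_nat_add fun i => c * w (k + i)
    simp only [add_comm _ (_ : ℕ)] at h ⊢
    exact h
  have hbd : ∀ k m x, ‖iterAvg w φ m k x - F k x‖ ≤ ∑' i, c * w (k + (m + i)) := fun k m x => by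
    rw [← dist_eq_norm]
    exact dist_le_tsum_of_dist_le_of_tendsto _ (hdist k x) (hsk k) (hF k x) m
  have hcont : ∀ k, Continuous (F k) := fun k => by
    have hu : TendstoUniformly (fun m => iterAvg w φ m k) (F k) atTop := by
      rw [Metric.tendstoUniformly_iff]
      intro ε hε
      filter_upwards [(htail k).eventually (gt_mem_nhds hε)] with m hm x
      rw [dist_comm, dist_eq_norm]
      exact (hbd k m x).trans_lt hm
    exact hu.continuous (Eventually.of_forall fun m => continuous_iterAvg hφ m k).frequently
  refine ⟨F, hcont, fun k => funext fun x => ?_, hF⟩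
  refine tendsto_nhds_unique ((tendsto_add_atTop_iff_nat 1).2 (hF k x)) ?_
  rw [tendsto_iff_norm_sub_tendsto_zero]
  refine squeeze_zero (fun _ => norm_nonneg _) (fun m => ?_) (htail (k + 1))
  rw [iterAvg, avg_sub (continuous_iterAvg hφ _ _) (hcont _)]
  exact norm_avg_le (hw k) fun y => hbd _ _ y

end IterAvg

section Family

variable {w : ℕ → ℝ} {F : ℕ → ℝ → ℂ}

lemma deriv_eq_of_avg (hc : ∀ k, Continuous (F k)) (hF : ∀ k, F k = avg (w k) (F (k + 1)))
    (k : ℕ) : deriv (F k) = fun x =>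
      ((1 / (2 * w k) : ℝ) : ℂ) * (F (k + 1) (x + w k) - F (k + 1) (x - w k)) := by
  funext x
  conv_lhs => rw [hF k]
  exact (hasDerivAt_avg (hc _) _ _).deriv

lemma contDiff_of_avg (hc : ∀ k, Continuous (F k)) (hF : ∀ k, F k = avg (w k) (F (k + 1)))
    (n k : ℕ) : ContDiff ℝ n (F k) := by
  induction n generalizing k with
  | zero => exact contDiff_zero.2 (hc k)
  | succ n ih =>
    rw [Nat.cast_add_one, contDiff_succ_iff_deriv]
    refine ⟨fun x => ?_, by simp, ?_⟩
    · rw [hF k]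
      exact (hasDerivAt_avg (hc _) _ _).differentiableAt
    · rw [deriv_eq_of_avg hc hF]
      exact contDiff_const.mul (((ih (k + 1)).comp (contDiff_id.add contDiff_const)).sub
        ((ih (k + 1)).comp (contDiff_id.sub contDiff_const)))

lemma norm_iteratedDeriv_le_of_avg (hw : ∀ i, 0 < w i) (hc : ∀ k, Continuous (F k))
    (hF : ∀ k, F k = avg (w k) (F (k + 1))) (h1 : ∀ k x, ‖F k x‖ ≤ 1) (n k : ℕ) (x : ℝ) :
    ‖iteratedDeriv n (F k) x‖ ≤ ∏ i ∈ Finset.range n, 1 / w (k + i) := by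
  induction n generalizing k x with
  | zero => simpa using h1 k x
  | succ n ih =>
    have hcd := contDiff_of_avg hc hF n (k + 1)
    have hp : ContDiff ℝ n fun x => F (k + 1) (x + w k) :=
      hcd.comp (contDiff_id.add contDiff_const)
    have hm : ContDiff ℝ n fun x => F (k + 1) (x - w k) :=
      hcd.comp (contDiff_id.sub contDiff_const)
    rw [iteratedDeriv_succ', deriv_eq_of_avg hc hF, iteratedDeriv_const_mul_field,
      iteratedDeriv_fun_sub hp.contDiffAt hm.contDiffAt, iteratedDeriv_comp_add_const,
      iteratedDeriv_comp_sub_const, Finset.prod_range_succ', norm_mul, Complex.norm_real,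
      Real.norm_of_nonneg (by have := hw k; positivity)]
    have e : ∏ i ∈ Finset.range n, 1 / w (k + (i + 1)) = ∏ i ∈ Finset.range n, 1 / w (k + 1 + i) :=
      Finset.prod_congr rfl fun i _ => by rw [show k + (i + 1) = k + 1 + i by ring]
    rw [e, add_zero]
    have hwk := hw k
    have hsub := (norm_sub_le (iteratedDeriv n (F (k + 1)) (x + w k))
      (iteratedDeriv n (F (k + 1)) (x - w k))).trans
      (add_le_add (ih (k + 1) (x + w k)) (ih (k + 1) (x - w k)))
    calc _ ≤ 1 / (2 * w k) * (_ + _) := by gcongr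
      _ = _ := by field_simp; ring

end Family

lemma exists_bump {w : ℕ → ℝ} (hw : ∀ i, 0 < w i) (hs : Summable w) {R : ℝ} (hR : 0 < R)
    (hwR : ∑' i, w i ≤ R) :
    ∃ χ : ℝ → ℂ, ContDiff ℝ (⊤ : ℕ∞) χ ∧ (∀ x, |x| ≤ R → χ x = 1) ∧
      (∀ x, 4 * R ≤ |x| → χ x = 0) ∧
      ∀ n x, ‖iteratedDeriv n χ x‖ ≤ ∏ i ∈ Finset.range n, 1 / w i := by
  let ψ : ℝ → ℝ := fun x => max 0 (min 1 (3 - |x| / R))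
  let φ : ℝ → ℂ := fun x => (ψ x : ℂ)
  have hψ : Continuous ψ := by fun_prop
  have hφ : Continuous φ := Complex.continuous_ofReal.comp hψ
  have hL : ∀ x y, ‖φ x - φ y‖ ≤ 1 / R * |x - y| := by
    intro x y
    rw [← Complex.ofReal_sub, Complex.norm_real, Real.norm_eq_abs]
    have h1 : |ψ x - ψ y| ≤ |min 1 (3 - |x| / R) - min 1 (3 - |y| / R)| := by
      have := abs_max_sub_max_le_abs (min 1 (3 - |x| / R)) (min 1 (3 - |y| / R)) (0 : ℝ)
      simpa only [ψ, max_comm (0 : ℝ)] using this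
    have h2 : |min 1 (3 - |x| / R) - min 1 (3 - |y| / R)| ≤ |(3 - |x| / R) - (3 - |y| / R)| := by
      simpa using abs_min_sub_min_le_max (1 : ℝ) (3 - |x| / R) 1 (3 - |y| / R)
    refine h1.trans (h2.trans ?_)
    rw [show (3 - |x| / R) - (3 - |y| / R) = 1 / R * (|y| - |x|) by ring, abs_mul,
      abs_of_pos (one_div_pos.2 hR), abs_sub_comm]
    exact mul_le_mul_of_nonneg_left (abs_abs_sub_abs_le x y) (by positivity)
  have hφ1 : ∀ x, ‖φ x‖ ≤ 1 := fun x => by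
    rw [Complex.norm_real, Real.norm_of_nonneg (le_max_left _ _)]
    exact max_le zero_le_one (min_le_left _ _)
  obtain ⟨F, hc, hF, hlim⟩ := exists_limit_iterAvg hφ hw hs hL (by positivity)
  have hsum : ∀ m, ∑ i ∈ Finset.range m, w (0 + i) ≤ R := fun m => by
    simp only [zero_add]
    exact (hs.sum_le_tsum _ fun i _ => (hw i).le).trans hwR
  refine ⟨F 0, contDiff_infty.2 fun n => contDiff_of_avg hc hF n 0, fun x hx => ?_,
    fun x hx => ?_, fun n x => ?_⟩
  · refine tendsto_nhds_unique (hlim 0 x) (tendsto_const_nhds.congr fun m => ?_)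
    refine (iterAvg_eq_of_forall_eq hw m 0 fun y hy => ?_).symm
    have h1 : |y| ≤ 2 * R := by
      have := abs_sub_abs_le_abs_sub y x
      linarith [hsum m]
    have h2 : |y| / R ≤ 2 := by rwa [div_le_iff₀ hR]
    have : ψ y = 1 := by
      simp only [ψ]
      rw [min_eq_left (by linarith)]
      exact max_eq_right zero_le_one
    simp [φ, this]
  · refine tendsto_nhds_unique (hlim 0 x) (tendsto_const_nhds.congr fun m => ?_)
    refine (iterAvg_eq_of_forall_eq hw m 0 fun y hy => ?_).symm
    have h1 : 3 * R ≤ |y| := by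
      have := abs_sub_abs_le_abs_sub x y
      rw [abs_sub_comm] at this
      linarith [hsum m]
    have h2 : 3 ≤ |y| / R := by rwa [le_div_iff₀ hR]
    have : ψ y = 0 := max_eq_left ((min_le_right _ _).trans (by linarith))
    simp [φ, this]
  · have hF1 : ∀ k x, ‖F k x‖ ≤ 1 := fun k x =>
      le_of_tendsto (hlim k x).norm (Eventually.of_forall fun m => norm_iterAvg_le hw hφ1 m k x)
    simpa using norm_iteratedDeriv_le_of_avg hw hc hF hF1 n 0 x

end Bump

section Minorant

lemma exists_prod_le_mul_prod {x y : ℕ → ℝ} (hx : ∀ i, 0 < x i) (hy : ∀ i, 0 < y i)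
    (hxy : ∀ᶠ i in atTop, x i ≤ y i) :
    ∃ C > 0, ∀ k, ∏ i ∈ Finset.range k, x i ≤ C * ∏ i ∈ Finset.range k, y i := by
  obtain ⟨m, hm⟩ := eventually_atTop.1 hxy
  let r : ℕ → ℝ := fun k => ∏ i ∈ Finset.range k, x i / y i
  have hr : ∀ k, 0 < r k := fun k => Finset.prod_pos fun i _ => div_pos (hx i) (hy i)
  refine ⟨∑ j ∈ Finset.range (m + 1), r j, Finset.sum_pos (fun j _ => hr j) (by simp), fun k => ?_⟩
  have h : r k ≤ ∑ j ∈ Finset.range (m + 1), r j := by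
    induction k with
    | zero =>
      exact Finset.single_le_sum (f := r) (fun j _ => (hr j).le)
        (Finset.mem_range.2 (Nat.succ_pos m))
    | succ k ih =>
      rcases lt_or_ge k m with hk | hk
      · exact Finset.single_le_sum (f := r) (fun j _ => (hr j).le)
          (Finset.mem_range.2 (Nat.succ_lt_succ hk))
      · refine le_trans ?_ ih
        simp only [r, Finset.prod_range_succ]
        exact mul_le_of_le_one_right (hr k).le ((div_le_one (hy k)).2 (hm k hk))
  rw [← div_le_iff₀ (Finset.prod_pos fun i _ => hy i), ← Finset.prod_div_distrib]
  exact h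

variable {N : ℕ → ℝ}

/-- A slowly growing factor by which the summable sequence `1 / nuq N` may be multiplied,
with control of all the tails. -/
lemma exists_slow_factor (hN : IsLC N) (hnq : NQA N) {ω : ℕ → ℝ} (hω : ∀ k, 0 < ω k)
    (hmono : Monotone ω) (htop : Tendsto ω atTop atTop) :
    ∃ θ : ℕ → ℝ, (∀ k, 0 < θ k) ∧ (∀ k, θ k ≤ ω k) ∧ Monotone θ ∧ Tendsto θ atTop atTop ∧
      θ 0 ≤ 1 ∧ 2 * θ 0 * tailSum N 0 ≤ 1 / 8 ∧
      ∀ p m, ∑ i ∈ Finset.range m, θ (p + i) / nuq N (p + i) ≤ 2 * θ p * tailSum N p := by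
  have hT := tailSum_pos hN hnq
  set S : ℕ → ℝ := fun k => √(tailSum N k) with hSdef
  have hS : ∀ k, 0 < S k := fun k => Real.sqrt_pos.2 (hT k)
  have hSS : ∀ k, S k * S k = tailSum N k := fun k => Real.mul_self_sqrt (hT k).le
  have hSanti : ∀ k, S (k + 1) ≤ S k := fun k => Real.sqrt_le_sqrt (tailSum_succ_le hN hnq k)
  have hSlim : Tendsto S atTop (nhds 0) := by
    simpa using (tendsto_tailSum N).sqrt
  obtain ⟨c, hc0, hcω, hc1, hcT⟩ : ∃ c, 0 < c ∧ c ≤ ω 0 ∧ c ≤ 1 ∧ 2 * c * tailSum N 0 ≤ 1 / 8 := by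
    refine ⟨min (ω 0) (min 1 (1 / (16 * tailSum N 0))), ?_, min_le_left _ _,
      (min_le_right _ _).trans (min_le_left _ _), ?_⟩
    · have := hT 0
      exact lt_min (hω 0) (lt_min one_pos (by positivity))
    · have h0 := hT 0
      have h : min (ω 0) (min 1 (1 / (16 * tailSum N 0))) ≤ 1 / (16 * tailSum N 0) :=
        (min_le_right _ _).trans (min_le_right _ _)
      rw [le_div_iff₀ (by positivity)] at h
      linarith
  obtain ⟨θ, hθ0, hθs⟩ : ∃ θ : ℕ → ℝ, θ 0 = c ∧
      ∀ k, θ (k + 1) = min (ω (k + 1)) (θ k * S k / S (k + 1)) :=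
    ⟨Nat.rec c fun k t => min (ω (k + 1)) (t * S k / S (k + 1)), rfl, fun _ => rfl⟩
  have hpos : ∀ k, 0 < θ k := by
    intro k
    induction k with
    | zero => rwa [hθ0]
    | succ k ih => rw [hθs]; exact lt_min (hω _) (div_pos (mul_pos ih (hS k)) (hS _))
  have hle : ∀ k, θ k ≤ ω k := by
    rintro (_ | k)
    · rwa [hθ0]
    · rw [hθs]; exact min_le_left _ _
  have hθmono : Monotone θ := by
    refine monotone_nat_of_le_succ fun k => ?_
    rw [hθs]
    refine le_min ((hle k).trans (hmono k.le_succ)) ?_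
    rw [le_div_iff₀ (hS _)]
    exact mul_le_mul_of_nonneg_left (hSanti k) (hpos k).le
  have hθS : Antitone fun k => θ k * S k := by
    refine antitone_nat_of_succ_le fun k => ?_
    rw [hθs, ← le_div_iff₀ (hS _)]
    exact min_le_right _ _
  refine ⟨θ, hpos, hle, hθmono, ?_, hθ0 ▸ hc1, hθ0 ▸ hcT, fun p m => ?_⟩
  · refine tendsto_atTop_atTop_of_monotone hθmono fun B => ?_
    by_contra! hB
    obtain ⟨m, hm⟩ := eventually_atTop.1 (htop.eventually_ge_atTop B)
    have hconst : ∀ i, θ (m + i) * S (m + i) = θ m * S m := by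
      intro i
      induction i with
      | zero => rfl
      | succ i ih =>
        have h1 : θ (m + i + 1) < ω (m + i + 1) := (hB _).trans_le (hm _ (by omega))
        have h2 : θ (m + i + 1) = θ (m + i) * S (m + i) / S (m + i + 1) := by
          rw [hθs] at h1 ⊢
          exact min_eq_right (by
            by_contra! hlt
            rw [min_eq_left hlt.le] at h1
            exact lt_irrefl _ h1)
        rw [← add_assoc, h2, div_mul_cancel₀ _ (hS _).ne', ih]
    have hlim : Tendsto (fun i => B * S (m + i)) atTop (nhds 0) := by
      have h := ((tendsto_add_atTop_iff_nat m).2 hSlim).const_mul B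
      simpa only [mul_zero, add_comm] using h
    have hge : θ m * S m ≤ 0 := ge_of_tendsto' hlim fun i => by
      rw [← hconst i]
      exact mul_le_mul_of_nonneg_right (hB _).le (hS _).le
    exact absurd hge (not_le.2 (mul_pos (hpos m) (hS m)))
  · have hterm : ∀ i, θ (p + i) / nuq N (p + i)
        ≤ 2 * (θ p * S p) * (S (p + i) - S (p + i + 1)) := by
      intro i
      have h1 : 1 / nuq N (p + i) = S (p + i) * S (p + i) - S (p + i + 1) * S (p + i + 1) := by
        rw [hSS, hSS, tailSum_eq hnq (p + i)]; ring
      have h2 : θ (p + i) * S (p + i) ≤ θ p * S p := hθS (Nat.le_add_right p i)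
      have h3 := hSanti (p + i)
      have h4 := hpos (p + i)
      calc θ (p + i) / nuq N (p + i) = θ (p + i) * (1 / nuq N (p + i)) := by ring
        _ = θ (p + i) * (S (p + i) + S (p + i + 1)) * (S (p + i) - S (p + i + 1)) := by
          rw [h1]; ring
        _ ≤ θ (p + i) * (S (p + i) + S (p + i)) * (S (p + i) - S (p + i + 1)) := by
          gcongr
        _ = 2 * (θ (p + i) * S (p + i)) * (S (p + i) - S (p + i + 1)) := by ring
        _ ≤ _ := by gcongr
    calc ∑ i ∈ Finset.range m, θ (p + i) / nuq N (p + i)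
        ≤ ∑ i ∈ Finset.range m, 2 * (θ p * S p) * (S (p + i) - S (p + i + 1)) :=
          Finset.sum_le_sum fun i _ => hterm i
      _ = 2 * (θ p * S p) * (S p - S (p + m)) := by
          rw [← Finset.mul_sum]
          congr 1
          exact Finset.sum_range_sub' (fun i => S (p + i)) m
      _ ≤ 2 * (θ p * S p) * S p := by
          have := hpos p
          have := hS p
          have := hS (p + m)
          gcongr
          linarith
      _ = 2 * θ p * tailSum N p := by rw [← hSS]; ring

/-- The minorant reducing the Beurling case to estimates with a single weight sequence. -/
lemma exists_minorant (hN : IsLC N) (hnq : NQA N) {s : ℕ} {ω : ℕ → ℝ} (hω : ∀ k, 0 < ω k)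
    (hmono : Monotone ω) (htop : Tendsto ω atTop atTop) :
    ∃ W : ℕ → ℝ, IsLC W ∧ NQA W ∧ tailSum W 1 ≤ 1 / 8 ∧
      (∀ h : ℝ, 0 < h → ∃ C : ℝ, 0 < C ∧ ∀ k, W k ≤ C * h ^ k * N k) ∧
      ∀ p, 1 ≤ p → Lseq N s p ≤ (s : ℝ) ^ p * (1 + 2 * ω p) ^ p * Lseq W 1 p := by
  obtain ⟨θ, hpos, hle, hθmono, hθtop, hθ1, hθ8, hsum⟩ := exists_slow_factor hN hnq hω hmono htop
  have hν := nuq_pos hN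
  obtain ⟨v, hv0, hvs⟩ : ∃ v : ℕ → ℝ, v 0 = nuq N 0 / θ 0 ∧
      ∀ k, v (k + 1) = max (v k) (nuq N (k + 1) / θ (k + 1)) :=
    ⟨Nat.rec (nuq N 0 / θ 0) fun k t => max t (nuq N (k + 1) / θ (k + 1)), rfl, fun _ => rfl⟩
  have hvmono : Monotone v := monotone_nat_of_le_succ fun k => by rw [hvs]; exact le_max_left _ _
  have hv1 : ∀ k, 1 ≤ v k := fun k => by
    refine le_trans ?_ (hvmono k.zero_le)
    rw [hv0, le_div_iff₀ (hpos 0)]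
    linarith [one_le_nuq hN 0]
  have hvpos : ∀ k, 0 < v k := fun k => one_pos.trans_le (hv1 k)
  have hvge : ∀ k, nuq N k / θ k ≤ v k := by
    rintro (_ | k)
    · exact hv0.ge
    · rw [hvs]; exact le_max_right _ _
  have hvinv : ∀ k, 1 / v k ≤ θ k / nuq N k := fun k => by
    rw [← one_div_div (nuq N k)]
    exact one_div_le_one_div_of_le (div_pos (hν k) (hpos k)) (hvge k)
  have hvsum : ∀ p m, ∑ i ∈ Finset.range m, 1 / v (p + i) ≤ 2 * θ p * tailSum N p := fun p m =>
    (Finset.sum_le_sum fun i _ => hvinv _).trans (hsum p m)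
  have hvsm : Summable fun k => 1 / v k :=
    summable_of_sum_range_le (fun k => (one_div_pos.2 (hvpos k)).le)
      fun m => by simpa using hvsum 0 m
  have hvtop : Tendsto v atTop atTop := by
    have h := hvsm.tendsto_atTop_zero
    refine tendsto_atTop_atTop_of_monotone hvmono fun B => ?_
    obtain ⟨k, hk⟩ := (h.eventually (gt_mem_nhds (show 0 < 1 / (|B| + 1) by positivity))).exists
    refine ⟨k, ?_⟩
    have := (one_div_lt_one_div (hvpos k) (by positivity)).1 hk
    linarith [le_abs_self B]
  let W : ℕ → ℝ := fun k => ∏ i ∈ Finset.range k, v (i + 1)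
  have hWs : ∀ k, W (k + 1) = W k * v (k + 1) := fun k => Finset.prod_range_succ _ _
  have hWpos : ∀ k, 0 < W k := fun k => Finset.prod_pos fun i _ => hvpos _
  have hWν : ∀ k, nuq W (k + 1) = v (k + 1) := fun k => by
    rw [nuq, Nat.add_sub_cancel, hWs, mul_div_cancel_left₀ _ (hWpos k).ne']
  have hNprod : ∀ k, N k = ∏ i ∈ Finset.range k, nuq N (i + 1) := fun k => by
    have h := weight_add hN 0 k
    simp only [zero_add, hN.2.1, one_mul] at h
    simpa only [add_comm] using h
  have hWtail : ∀ p, 1 ≤ p → tailSum W p = ∑' k, 1 / v (p + k) := fun p hp => by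
    rw [tailSum]
    refine tsum_congr fun k => ?_
    obtain ⟨q, hq⟩ : ∃ q, p + k = q + 1 := ⟨p + k - 1, by omega⟩
    rw [hq, hWν]
  have hWtail' : ∀ p, 1 ≤ p → tailSum W p ≤ 2 * θ p * tailSum N p := fun p hp => by
    rw [hWtail p hp]
    exact Real.tsum_le_of_sum_range_le (fun k => (one_div_pos.2 (hvpos _)).le) (hvsum p)
  have hWnq : NQA W := by
    simp only [NQA, hWν]
    exact (summable_nat_add_iff 1).2 hvsm
  have hWlc : IsLC W := by
    refine ⟨hWpos, by simp [W], by simpa [W] using hv1 1, fun p hp => ?_, ?_⟩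
    · obtain ⟨q, rfl⟩ : ∃ q, p = q + 1 := ⟨p - 1, by omega⟩
      rw [Nat.add_sub_cancel, hWs (q + 1), hWs q]
      have h1 := hvmono (Nat.le_succ (q + 1))
      have h2 := hvpos (q + 1)
      have h3 := hWpos q
      calc (W q * v (q + 1)) ^ 2 = W q * (W q * v (q + 1) * v (q + 1)) := by ring
        _ ≤ W q * (W q * v (q + 1) * v (q + 1 + 1)) := by gcongr
    · refine tendsto_atTop.2 fun A => ?_
      obtain ⟨C, hC, h⟩ := exists_prod_le_mul_prod (x := fun _ => 2 * (|A| + 1))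
        (y := fun i => v (i + 1)) (fun _ => by positivity) (fun i => hvpos _)
        (((tendsto_add_atTop_iff_nat 1).2 hvtop).eventually_ge_atTop _)
      filter_upwards [(tendsto_pow_atTop_atTop_of_one_lt
          (one_lt_two (α := ℝ))).eventually_ge_atTop C,
        eventually_ge_atTop 1] with k hk hk1
      have h1 : (|A| + 1) ^ k ≤ W k := by
        have h2 := h k
        rw [Finset.prod_const, Finset.card_range, mul_pow] at h2
        have h3 : C * (|A| + 1) ^ k ≤ C * W k :=
          (mul_le_mul_of_nonneg_right hk (by positivity)).trans h2
        exact le_of_mul_le_mul_left h3 hC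
      calc A ≤ |A| + 1 := by linarith [le_abs_self A]
        _ = ((|A| + 1) ^ k) ^ ((1 : ℝ) / k) := by
          rw [one_div, Real.pow_rpow_inv_natCast (by positivity) (by omega)]
        _ ≤ _ := Real.rpow_le_rpow (by positivity) h1 (by positivity)
  refine ⟨W, hWlc, hWnq, ?_, fun h hh => ?_, fun p hp => ?_⟩
  · rw [hWtail 1 le_rfl]
    refine Real.tsum_le_of_sum_range_le (fun k => (one_div_pos.2 (hvpos _)).le) fun m => ?_
    refine le_trans ?_ ((hvsum 0 (m + 1)).trans hθ8)
    simp only [Finset.sum_range_succ', zero_add, add_comm 1]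
    linarith [one_div_pos.2 (hvpos 0)]
  · have hνtop : Tendsto (nuq N) atTop atTop := by
      refine tendsto_atTop_mono' _ ?_ tendsto_natCast_atTop_atTop
      filter_upwards [eventually_mul_le_nuq hN hnq 1] with k hk
      rwa [one_mul] at hk
    have hev : ∀ᶠ k in atTop, v k ≤ h * nuq N k := by
      obtain ⟨m, hm⟩ := eventually_atTop.1 (hθtop.eventually_ge_atTop (1 / h))
      have hmax : ∀ k, v k ≤ max (v m) (h * nuq N k) := by
        intro k
        induction k with
        | zero => exact (hvmono m.zero_le).trans (le_max_left _ _)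
        | succ k ih =>
          rcases lt_or_ge k m with hk | hk
          · exact (hvmono hk).trans (le_max_left _ _)
          · have h1 : nuq N (k + 1) / θ (k + 1) ≤ h * nuq N (k + 1) := by
              rw [div_le_iff₀ (hpos _)]
              have h2 := hm (k + 1) (by omega)
              rw [div_le_iff₀ hh] at h2
              nlinarith [hν (k + 1)]
            rw [hvs]
            refine max_le (ih.trans (max_le_max le_rfl ?_)) (h1.trans (le_max_right _ _))
            exact mul_le_mul_of_nonneg_left (nuq_le_succ hN k) hh.le
      filter_upwards [hνtop.eventually_ge_atTop (v m / h)] with k hk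
      rw [div_le_iff₀' hh] at hk
      exact (hmax k).trans (max_le hk le_rfl)
    obtain ⟨C, hC, hb⟩ := exists_prod_le_mul_prod (x := fun i => v (i + 1))
      (y := fun i => h * nuq N (i + 1)) (fun i => hvpos _) (fun i => mul_pos hh (hν _))
      ((tendsto_add_atTop_nat 1).eventually hev)
    refine ⟨C, hC, fun k => (hb k).trans_eq ?_⟩
    rw [Finset.prod_mul_distrib, Finset.prod_const, Finset.card_range, ← hNprod, mul_assoc]
  · obtain ⟨j, hj, hL⟩ := exists_Lseq_eq W 1 hp
    have hτ := tailSum_pos hWlc hWnq p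
    have hT := tailSum_pos hN hnq p
    have hωp := hω p
    have h1 : p / tailSum N p ≤ (1 + 2 * ω p) * (p / tailSum W p) := by
      rw [← mul_div_assoc, div_le_div_iff₀ hT hτ, mul_comm _ (p : ℝ), mul_assoc]
      refine mul_le_mul_of_nonneg_left ((hWtail' p hp).trans ?_) (Nat.cast_nonneg p)
      gcongr
      linarith [hle p]
    have h2 : N j ≤ (1 + 2 * ω p) ^ j * W j := by
      rw [hNprod j, ← Finset.card_range j, ← Finset.prod_const, Finset.card_range,
        ← Finset.prod_mul_distrib]
      refine Finset.prod_le_prod (fun i _ => (hν _).le) fun i hi => ?_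
      have hi' := Finset.mem_range.1 hi
      have h3 := hvge (i + 1)
      rw [div_le_iff₀' (hpos _)] at h3
      refine h3.trans (mul_le_mul_of_nonneg_right ?_ (hvpos _).le)
      linarith [hle (i + 1), hmono (show i + 1 ≤ p by omega)]
    refine (Lseq_le N s hj).trans ?_
    have hNj := hN.1 j
    rw [hL, Nat.cast_one, one_pow, one_mul, mul_assoc]
    refine mul_le_mul_of_nonneg_left ?_ (by positivity)
    calc (p / tailSum N p) ^ (p - j) * N j
        ≤ ((1 + 2 * ω p) * (p / tailSum W p)) ^ (p - j) * ((1 + 2 * ω p) ^ j * W j) := by gcongr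
      _ = (1 + 2 * ω p) ^ (p - j + j) * ((p / tailSum W p) ^ (p - j) * W j) := by
        rw [mul_pow, pow_add]; ring
      _ = _ := by rw [Nat.sub_add_cancel hj.le]

end Minorant

section Cutoff

variable {N : ℕ → ℝ}

/-- The bound for the `n`-th derivative of the cutoff function used at order `p`. -/
noncomputable def cutoffBound (N : ℕ → ℝ) (p n : ℕ) : ℝ :=
  ∏ i ∈ Finset.range n, if i < p then p / tailSum N p else nuq N (i + 1)

lemma cutoffBound_of_le (N : ℕ → ℝ) {p n : ℕ} (hn : n ≤ p) :
    cutoffBound N p n = (p / tailSum N p) ^ n := by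
  rw [cutoffBound, Finset.prod_congr rfl fun i hi =>
    if_pos ((Finset.mem_range.1 hi).trans_le hn), Finset.prod_const, Finset.card_range]

lemma cutoffBound_mul (hN : IsLC N) {p n : ℕ} (hn : p ≤ n) :
    cutoffBound N p n * N p = (p / tailSum N p) ^ p * N n := by
  obtain ⟨m, rfl⟩ := Nat.exists_eq_add_of_le hn
  rw [cutoffBound, Finset.prod_range_add, ← cutoffBound, cutoffBound_of_le N le_rfl,
    weight_add hN, mul_assoc, mul_comm (N p)]
  congr 2
  refine Finset.prod_congr rfl fun i _ => ?_
  rw [if_neg (by omega), show p + i + 1 = p + 1 + i by ring]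

lemma exists_cutoff (hN : IsLC N) (hnq : NQA N) {p : ℕ} (hp : 1 ≤ p) :
    ∃ χ : ℝ → ℂ, ContDiff ℝ (⊤ : ℕ∞) χ ∧ (∀ x, |x| ≤ 2 * tailSum N p → χ x = 1) ∧
      (∀ x, 8 * tailSum N p ≤ |x| → χ x = 0) ∧
      ∀ n x, ‖iteratedDeriv n χ x‖ ≤ cutoffBound N p n := by
  have hτ := tailSum_pos hN hnq p
  have hp0 : (0 : ℝ) < p := by exact_mod_cast hp
  have hν := nuq_pos hN
  let w : ℕ → ℝ := fun i => if i < p then tailSum N p / p else 1 / nuq N (i + 1)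
  have hw : ∀ i, 0 < w i := fun i => by
    simp only [w]
    split_ifs
    · positivity
    · exact one_div_pos.2 (hν _)
  have hwadd : ∀ m, w (m + p) = 1 / nuq N (p + 1 + m) := fun m => by
    simp only [w]
    rw [if_neg (by omega), show m + p + 1 = p + 1 + m by ring]
  have hs : Summable w := by
    refine (summable_nat_add_iff p).1 ?_
    simp only [hwadd]
    exact summable_inv_nuq_add hnq (p + 1)
  have hsum : ∑' i, w i ≤ 2 * tailSum N p := by
    rw [← hs.sum_add_tsum_nat_add p]
    simp only [hwadd]
    have h1 : ∑ i ∈ Finset.range p, w i = tailSum N p := by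
      rw [Finset.sum_congr rfl fun i hi => if_pos (Finset.mem_range.1 hi), Finset.sum_const,
        Finset.card_range, nsmul_eq_mul, mul_div_cancel₀ _ hp0.ne']
    have h2 := tailSum_succ_le hN hnq p
    rw [tailSum] at h2
    linarith
  obtain ⟨χ, h1, h2, h3, h4⟩ := exists_bump hw hs (by positivity) hsum
  refine ⟨χ, h1, h2, fun x hx => h3 x (by linarith), fun n x => (h4 n x).trans_eq ?_⟩
  refine Finset.prod_congr rfl fun i _ => ?_
  simp only [w]
  split_ifs
  · rw [one_div_div]
  · rw [one_div_one_div]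

lemma pow_le_exp_mul_prod (hN : IsLC N) (hnq : NQA N) (p m : ℕ) :
    ((p : ℝ) / tailSum N p) ^ m ≤ Real.exp p * ∏ i ∈ Finset.range m, nuq N (p + i) := by
  have hτ := tailSum_pos hN hnq p
  have hν := nuq_pos hN
  set X : ℝ := p / tailSum N p with hX
  have hX0 : 0 ≤ X := by positivity
  calc X ^ m = ∏ i ∈ Finset.range m, (X * (1 / nuq N (p + i))) * nuq N (p + i) := by
        rw [Finset.prod_congr rfl fun i _ => show X * (1 / nuq N (p + i)) * nuq N (p + i) = X by
          have := (hν (p + i)).ne'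
          field_simp]
        simp
    _ ≤ ∏ i ∈ Finset.range m, Real.exp (X * (1 / nuq N (p + i))) * nuq N (p + i) := by
        refine Finset.prod_le_prod (fun i _ => ?_) fun i _ => ?_
        · have := hν (p + i)
          positivity
        · refine mul_le_mul_of_nonneg_right ?_ (hν _).le
          linarith [Real.add_one_le_exp (X * (1 / nuq N (p + i)))]
    _ = Real.exp (X * ∑ i ∈ Finset.range m, 1 / nuq N (p + i))
          * ∏ i ∈ Finset.range m, nuq N (p + i) := by
        rw [Finset.prod_mul_distrib, Finset.mul_sum, Real.exp_sum]
    _ ≤ Real.exp p * ∏ i ∈ Finset.range m, nuq N (p + i) := by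
        refine mul_le_mul_of_nonneg_right (Real.exp_le_exp.2 ?_)
          (Finset.prod_nonneg fun i _ => (hν _).le)
        calc _ ≤ X * tailSum N p :=
              mul_le_mul_of_nonneg_left (sum_inv_nuq_le_tailSum hN hnq p m) hX0
          _ = p := by rw [hX]; field_simp

lemma Lseq_mul_cutoffBound_le (hN : IsLC N) (hnq : NQA N) {p i k : ℕ} (hp : 1 ≤ p) (hip : i ≤ p)
    (hik : i ≤ k) : Lseq N 1 p * cutoffBound N p (k - i)
      ≤ Real.exp p * (p / tailSum N p) ^ (p - i) * N k := by
  have hτ := tailSum_pos hN hnq p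
  have hp0 : (0 : ℝ) < p := by exact_mod_cast hp
  have hν := nuq_pos hN
  have hL : ∀ j < p, Lseq N 1 p ≤ (p / tailSum N p) ^ (p - j) * N j := fun j hj => by
    simpa using Lseq_le N 1 hj
  have hpow := pow_le_exp_mul_prod hN hnq p
  set X : ℝ := p / tailSum N p with hX
  have hX0 : 0 < X := by positivity
  have hexp : 1 ≤ Real.exp p := Real.one_le_exp hp0.le
  obtain ⟨q, rfl⟩ : ∃ q, p = q + 1 := ⟨p - 1, by omega⟩
  rcases lt_or_ge k (q + 1) with hk | hk
  · rw [cutoffBound_of_le N (by omega), ← hX]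
    have hNk := hN.1 k
    calc Lseq N 1 (q + 1) * X ^ (k - i) ≤ X ^ (q + 1 - k) * N k * X ^ (k - i) := by
          gcongr
          exact hL k hk
      _ = 1 * X ^ (q + 1 - i) * N k := by
          rw [show q + 1 - i = (q + 1 - k) + (k - i) by omega, pow_add]; ring
      _ ≤ _ := by gcongr
  have hLq : Lseq N 1 (q + 1) ≤ X * N q := by simpa using hL q (by omega)
  have hNq := hN.1 q
  rcases le_or_gt (k - i) (q + 1) with hki | hki
  · rw [cutoffBound_of_le N hki, ← hX]
    have h1 := weight_add hN q (k - q)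
    rw [show q + (k - q) = k by omega] at h1
    calc Lseq N 1 (q + 1) * X ^ (k - i) ≤ X * N q * X ^ (k - i) := by gcongr
      _ = X ^ (q + 1 - i) * N q * X ^ (k - q) := by
          have e : X * X ^ (k - i) = X ^ (q + 1 - i) * X ^ (k - q) := by
            rw [← pow_succ', ← pow_add]; congr 1; omega
          linear_combination N q * e
      _ ≤ X ^ (q + 1 - i) * N q *
          (Real.exp (q + 1 : ℕ) * ∏ i ∈ Finset.range (k - q), nuq N (q + 1 + i)) := by
          gcongr
          exact hpow _
      _ = _ := by rw [h1]; ring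
  · have hD := cutoffBound_mul hN hki.le
    rw [← hX, ← nuq_succ_mul hN q] at hD
    have hνq := hν (q + 1)
    have hD' : N q * cutoffBound N (q + 1) (k - i)
        = X ^ (q + 1) * N (k - i) / nuq N (q + 1) := by
      rw [eq_div_iff hνq.ne']; linear_combination hD
    have h1 := weight_add hN (k - i) i
    rw [Nat.sub_add_cancel hik] at h1
    have hNki := hN.1 (k - i)
    have h2 : ∏ j ∈ Finset.range i, nuq N (q + 1 + (j + 1))
        ≤ ∏ j ∈ Finset.range i, nuq N (k - i + 1 + j) :=
      Finset.prod_le_prod (fun j _ => (hν _).le) fun j _ => nuq_monotone hN (by omega)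
    have hD0 : 0 ≤ cutoffBound N (q + 1) (k - i) := Finset.prod_nonneg fun j _ => by
      split_ifs
      · exact hX0.le
      · exact (hν _).le
    have h3 : X ^ (i + 1) / nuq N (q + 1)
        ≤ Real.exp (q + 1 : ℕ) * ∏ j ∈ Finset.range i, nuq N (k - i + 1 + j) := by
      rw [div_le_iff₀ hνq]
      refine (hpow (i + 1)).trans ?_
      rw [Finset.prod_range_succ', add_zero, ← mul_assoc]
      gcongr
    calc Lseq N 1 (q + 1) * cutoffBound N (q + 1) (k - i)
        ≤ X * N q * cutoffBound N (q + 1) (k - i) := by gcongr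
      _ = X * (X ^ (q + 1) * N (k - i) / nuq N (q + 1)) := by rw [mul_assoc, hD']
      _ = X ^ (q + 1 - i) * (X ^ (i + 1) / nuq N (q + 1)) * N (k - i) := by
          have e : X * X ^ (q + 1) = X ^ (q + 1 - i) * X ^ (i + 1) := by
            rw [← pow_succ', ← pow_add]; congr 1; omega
          field_simp
          linear_combination e
      _ ≤ X ^ (q + 1 - i) *
          (Real.exp (q + 1 : ℕ) * ∏ j ∈ Finset.range i, nuq N (k - i + 1 + j)) * N (k - i) := by
          gcongr
      _ = _ := by rw [h1]; ring

end Cutoff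

section Monomial

variable {N : ℕ → ℝ}

lemma iteratedDeriv_monoDeriv (p n : ℕ) :
    iteratedDeriv n (fun x => (monoDeriv p 0 x : ℂ)) = fun x => (monoDeriv p n x : ℂ) := by
  induction n with
  | zero => exact iteratedDeriv_zero
  | succ n ih =>
    rw [iteratedDeriv_succ, ih]
    exact funext fun x => (hasDerivAt_monoDeriv p n x).ofReal_comp.deriv

lemma contDiff_monoDeriv (p : ℕ) : ContDiff ℝ (⊤ : ℕ∞) fun x => (monoDeriv p 0 x : ℂ) := by
  simp only [monoDeriv, Nat.zero_le, if_true]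
  exact Complex.ofRealCLM.contDiff.comp ((contDiff_id.pow _).div_const _)

lemma norm_monoDeriv_le {p : ℕ} (hp : 1 ≤ p) {t x : ℝ} (ht : 0 < t) (hx : |x| ≤ 8 * t) {i : ℕ}
    (hi : i ≤ p) :
    ‖(monoDeriv p i x : ℂ)‖ * (p / t) ^ (p - i) ≤ (8 * Real.exp 1) ^ p := by
  have hp0 : (0 : ℝ) < p := by exact_mod_cast hp
  rw [monoDeriv, if_pos hi, Complex.norm_real, Real.norm_eq_abs, abs_div, abs_pow, Nat.abs_cast]
  calc |x| ^ (p - i) / ((p - i).factorial : ℝ) * (p / t) ^ (p - i)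
      ≤ (8 * t) ^ (p - i) / ((p - i).factorial : ℝ) * (p / t) ^ (p - i) := by gcongr
    _ = 8 ^ (p - i) * ((p : ℝ) ^ (p - i) / ((p - i).factorial : ℝ)) := by
        rw [mul_pow, div_pow]; field_simp
    _ ≤ 8 ^ p * Real.exp p := by
        gcongr
        · norm_num
        · exact Nat.sub_le _ _
        · exact Real.pow_div_factorial_le_exp _ hp0.le _
    _ = (8 * Real.exp 1) ^ p := by rw [mul_pow, ← Real.exp_nat_mul, mul_one]

/-- A compactly supported function with a single nonzero derivative at the origin. -/
lemma exists_monomial_cutoff (hN : IsLC N) (hnq : NQA N) {p : ℕ} (hp : 1 ≤ p)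
    (hT : tailSum N p ≤ 1 / 8) :
    ∃ g : ℝ → ℂ, ContDiff ℝ (⊤ : ℕ∞) g ∧ Function.support g ⊆ Set.Icc (-1 : ℝ) 1 ∧
      (∀ k, iteratedDeriv k g 0 = if k = p then 1 else 0) ∧
      ∀ k x, Lseq N 1 p * ‖iteratedDeriv k g x‖ ≤ (8 * Real.exp 2) ^ p * 2 ^ k * N k := by
  have hτ := tailSum_pos hN hnq p
  have hp0 : (0 : ℝ) < p := by exact_mod_cast hp
  obtain ⟨χ, hχ, hχ1, hχ0, hχb⟩ := exists_cutoff hN hnq hp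
  have hL0 := Lseq_pos hN hnq le_rfl p
  have hmd := contDiff_monoDeriv p
  refine ⟨fun x => (monoDeriv p 0 x : ℂ) * χ x, hmd.mul hχ, fun x hx => ?_, fun k => ?_,
    fun k x => ?_⟩
  · have h : |x| < 8 * tailSum N p := by
      by_contra! h
      exact hx (by simp [hχ0 x h])
    exact abs_le.1 (by linarith)
  · have h : (fun x => (monoDeriv p 0 x : ℂ) * χ x) =ᶠ[nhds 0] fun x => (monoDeriv p 0 x : ℂ) := by
      filter_upwards [Metric.ball_mem_nhds (0 : ℝ) (show 0 < 2 * tailSum N p by positivity)]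
        with x hx
      rw [Metric.mem_ball, dist_zero_right, Real.norm_eq_abs] at hx
      rw [hχ1 x hx.le, mul_one]
    rw [h.iteratedDeriv_eq, iteratedDeriv_monoDeriv]
    simp only [monoDeriv_zero]
    split_ifs <;> simp
  · have hNk := hN.1 k
    rcases lt_or_ge (8 * tailSum N p) |x| with hx | hx
    · have h : (fun x => (monoDeriv p 0 x : ℂ) * χ x) =ᶠ[nhds x] fun _ => 0 := by
        filter_upwards [(isOpen_lt continuous_const continuous_abs).mem_nhds hx] with y hy
        rw [hχ0 y (le_of_lt hy), mul_zero]
      rw [h.iteratedDeriv_eq, iteratedDeriv_const]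
      simp only [ite_self, norm_zero, mul_zero]
      positivity
    · have hm : ContDiffAt ℝ k (fun x => (monoDeriv p 0 x : ℂ)) x :=
        (contDiff_infty.1 hmd k).contDiffAt
      have hc : ContDiffAt ℝ k χ x := (contDiff_infty.1 hχ k).contDiffAt
      rw [iteratedDeriv_fun_mul hm hc]
      set X : ℝ := p / tailSum N p with hX
      have hX0 : 0 < X := by positivity
      have hterm : ∀ i ≤ k, Lseq N 1 p *
          (‖iteratedDeriv i (fun x => (monoDeriv p 0 x : ℂ)) x‖ * ‖iteratedDeriv (k - i) χ x‖)
            ≤ (8 * Real.exp 2) ^ p * N k := by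
        intro i hi
        rw [iteratedDeriv_monoDeriv]
        rcases le_or_gt i p with hip | hip
        · have h1 := norm_monoDeriv_le hp hτ hx hip
          have h2 := Lseq_mul_cutoffBound_le hN hnq hp hip hi
          rw [← hX] at h1 h2
          calc Lseq N 1 p * (‖(monoDeriv p i x : ℂ)‖ * ‖iteratedDeriv (k - i) χ x‖)
              ≤ Lseq N 1 p * (‖(monoDeriv p i x : ℂ)‖ * cutoffBound N p (k - i)) := by
                gcongr
                exact hχb _ _
            _ = ‖(monoDeriv p i x : ℂ)‖ * (Lseq N 1 p * cutoffBound N p (k - i)) := by ring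
            _ ≤ ‖(monoDeriv p i x : ℂ)‖ * (Real.exp p * X ^ (p - i) * N k) := by gcongr
            _ = ‖(monoDeriv p i x : ℂ)‖ * X ^ (p - i) * (Real.exp p * N k) := by ring
            _ ≤ (8 * Real.exp 1) ^ p * (Real.exp p * N k) := by gcongr
            _ = (8 * Real.exp 2) ^ p * N k := by
                rw [mul_pow, mul_pow, ← Real.exp_nat_mul, ← Real.exp_nat_mul,
                  show (p : ℝ) * 2 = p * 1 + p by ring, Real.exp_add]
                ring
        · simp only [monoDeriv, if_neg (not_le.2 hip), Complex.ofReal_zero, norm_zero, zero_mul,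
            mul_zero]
          positivity
      calc _ ≤ Lseq N 1 p * ∑ i ∈ Finset.range (k + 1), (k.choose i : ℝ) *
            (‖iteratedDeriv i (fun x => (monoDeriv p 0 x : ℂ)) x‖ *
              ‖iteratedDeriv (k - i) χ x‖) := by
            gcongr
            refine (norm_sum_le _ _).trans_eq (Finset.sum_congr rfl fun i _ => ?_)
            rw [norm_mul, norm_mul, RCLike.norm_natCast, mul_assoc]
        _ = ∑ i ∈ Finset.range (k + 1), (k.choose i : ℝ) * (Lseq N 1 p *
            (‖iteratedDeriv i (fun x => (monoDeriv p 0 x : ℂ)) x‖ *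
              ‖iteratedDeriv (k - i) χ x‖)) := by
            rw [Finset.mul_sum]
            exact Finset.sum_congr rfl fun i _ => by ring
        _ ≤ ∑ i ∈ Finset.range (k + 1), (k.choose i : ℝ) * ((8 * Real.exp 2) ^ p * N k) := by
            refine Finset.sum_le_sum fun i hi => ?_
            exact mul_le_mul_of_nonneg_left
              (hterm i (Nat.lt_succ_iff.1 (Finset.mem_range.1 hi))) (Nat.cast_nonneg _)
        _ = _ := by
            have h : ∑ i ∈ Finset.range (k + 1), (k.choose i : ℝ) = 2 ^ k := by
              exact_mod_cast Nat.sum_range_choose k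
            rw [← Finset.sum_mul, h]; ring

/-- The analogue of `exists_monomial_cutoff` at order `0`. -/
lemma exists_constant_cutoff (hN : IsLC N) (hnq : NQA N) (hT : tailSum N 1 ≤ 1 / 8) :
    ∃ g : ℝ → ℂ, ContDiff ℝ (⊤ : ℕ∞) g ∧ Function.support g ⊆ Set.Icc (-1 : ℝ) 1 ∧
      (∀ k, iteratedDeriv k g 0 = if k = 0 then 1 else 0) ∧
      ∃ C ≥ 1, ∀ k x, ‖iteratedDeriv k g x‖ ≤ C * N k := by
  have hτ := tailSum_pos hN hnq 1
  obtain ⟨χ, hχ, hχ1, hχ0, hχb⟩ := exists_cutoff hN hnq le_rfl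
  refine ⟨χ, hχ, fun x hx => ?_, fun k => ?_, 1 + 1 / tailSum N 1,
    by have := one_div_pos.2 hτ; linarith, fun k x => (hχb k x).trans ?_⟩
  · have h : |x| < 8 * tailSum N 1 := by
      by_contra! h
      exact hx (hχ0 x h)
    exact abs_le.1 (by linarith)
  · have h : χ =ᶠ[nhds 0] fun _ => 1 := by
      filter_upwards [Metric.ball_mem_nhds (0 : ℝ) (show 0 < 2 * tailSum N 1 by positivity)]
        with x hx
      rw [Metric.mem_ball, dist_zero_right, Real.norm_eq_abs] at hx
      exact hχ1 x hx.le
    rw [h.iteratedDeriv_eq, iteratedDeriv_const]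
  · have hτ' := one_div_pos.2 hτ
    have hNk := one_le_weight hN k
    rcases Nat.eq_zero_or_pos k with rfl | hk
    · rw [cutoffBound_of_le N zero_le_one, pow_zero]
      nlinarith
    · have h := cutoffBound_mul hN (show 1 ≤ k from hk)
      rw [Nat.cast_one, pow_one] at h
      have hD : 0 ≤ cutoffBound N 1 k := Finset.prod_nonneg fun j _ => by
        split_ifs
        · positivity
        · exact (nuq_pos hN _).le
      nlinarith [one_le_weight hN 1]

end Monomial

section Sufficiency

variable {N : ℕ → ℝ}

lemma iteratedDeriv_tsum {g : ℕ → ℝ → ℂ} (hg : ∀ p, ContDiff ℝ (⊤ : ℕ∞) (g p)) {u : ℕ → ℕ → ℝ}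
    (hu : ∀ k, Summable (u k)) (hb : ∀ k p x, ‖iteratedDeriv k (g p) x‖ ≤ u k p) (k : ℕ) (x : ℝ) :
    iteratedDeriv k (fun y => ∑' p, g p y) x = ∑' p, iteratedDeriv k (g p) x := by
  simp only [iteratedDeriv_eq_equiv_comp, Function.comp_apply]
  rw [iteratedFDeriv_tsum_apply (v := u) (N := (⊤ : ℕ∞)) hg (fun k _ => hu k)
    (fun k p x _ => norm_iteratedFDeriv_eq_norm_iteratedDeriv.trans_le (hb k p x)) le_top]
  exact (ContinuousMultilinearMap.piFieldEquiv ℝ (Fin k) ℂ).symm.toContinuousLinearEquiv.map_tsum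

/-- Sequences that are small against `Lseq N 1` are values of the Borel map, with control of all
derivatives by a geometric multiple of `N`. -/
lemma exists_function_of_jet (hN : IsLC N) (hnq : NQA N) (hT : tailSum N 1 ≤ 1 / 8) {a : ℕ → ℂ}
    {C : ℝ} (ha : ∀ p, ‖a p‖ * (16 * Real.exp 2) ^ p ≤ C * Lseq N 1 p) :
    ∃ f : ℝ → ℂ, ContDiff ℝ (⊤ : ℕ∞) f ∧ Function.support f ⊆ Set.Icc (-1 : ℝ) 1 ∧
      BorelMap f = a ∧ ∃ C' > 0, ∀ k x, ‖iteratedDeriv k f x‖ ≤ C' * 2 ^ k * N k := by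
  have hL := Lseq_pos hN hnq (le_refl 1)
  have hC : 0 ≤ C := by
    have h := ha 0
    simp only [Lseq, if_true, pow_zero, mul_one] at h
    exact (norm_nonneg _).trans h
  obtain ⟨B, hB, hex⟩ : ∃ B ≥ (1 : ℝ), ∀ p, ∃ g : ℝ → ℂ, ContDiff ℝ (⊤ : ℕ∞) g ∧
      Function.support g ⊆ Set.Icc (-1 : ℝ) 1 ∧
      (∀ k, iteratedDeriv k g 0 = if k = p then 1 else 0) ∧
      ∀ k x, Lseq N 1 p * ‖iteratedDeriv k g x‖ ≤ B * (8 * Real.exp 2) ^ p * 2 ^ k * N k := by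
    obtain ⟨g, h1, h2, h3, B, hB, h4⟩ := exists_constant_cutoff hN hnq hT
    refine ⟨B, hB, fun p => ?_⟩
    rcases Nat.eq_zero_or_pos p with rfl | hp
    · refine ⟨g, h1, h2, h3, fun k x => ?_⟩
      have h5 : (1 : ℝ) ≤ 2 ^ k := one_le_pow₀ one_le_two
      have hNk := hN.1 k
      simp only [Lseq, if_true, one_mul, pow_zero, mul_one]
      refine (h4 k x).trans ?_
      gcongr
      nlinarith
    · obtain ⟨g, h1, h2, h3, h4⟩ :=
        exists_monomial_cutoff hN hnq hp ((tailSum_antitone hN hnq hp).trans hT)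
      refine ⟨g, h1, h2, h3, fun k x => (h4 k x).trans ?_⟩
      have hNk := hN.1 k
      rw [mul_assoc, mul_assoc, mul_assoc B]
      exact le_mul_of_one_le_left (by positivity) hB
  choose g hg hgs hg0 hgb using hex
  let G : ℕ → ℝ → ℂ := fun p x => a p * g p x
  have hG : ∀ p, ContDiff ℝ (⊤ : ℕ∞) (G p) := fun p => contDiff_const.mul (hg p)
  have hGd : ∀ k p x, iteratedDeriv k (G p) x = a p * iteratedDeriv k (g p) x := fun k p x =>
    iteratedDeriv_const_mul_field _ _
  let u : ℕ → ℕ → ℝ := fun k p => B * C * 2 ^ k * N k * (1 / 2) ^ p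
  have hu : ∀ k, HasSum (u k) (B * C * 2 ^ k * N k * 2) := fun k => hasSum_geometric_two.mul_left _
  have hGb : ∀ k p x, ‖iteratedDeriv k (G p) x‖ ≤ u k p := by
    intro k p x
    have hNk := hN.1 k
    have hLp := hL p
    rw [hGd, norm_mul]
    refine le_of_mul_le_mul_left ?_ hLp
    have e : (16 * Real.exp 2) ^ p = (8 * Real.exp 2) ^ p * 2 ^ p := by
      rw [← mul_pow]; congr 1; ring
    have h1 : ‖a p‖ * (8 * Real.exp 2) ^ p ≤ C * Lseq N 1 p * (1 / 2) ^ p := by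
      have h2 := ha p
      rw [e, ← mul_assoc] at h2
      rw [one_div, inv_pow, ← div_eq_mul_inv, le_div_iff₀ (by positivity)]
      exact h2
    calc Lseq N 1 p * (‖a p‖ * ‖iteratedDeriv k (g p) x‖)
        = ‖a p‖ * (Lseq N 1 p * ‖iteratedDeriv k (g p) x‖) := by ring
      _ ≤ ‖a p‖ * (B * (8 * Real.exp 2) ^ p * 2 ^ k * N k) :=
          mul_le_mul_of_nonneg_left (hgb p k x) (norm_nonneg _)
      _ = ‖a p‖ * (8 * Real.exp 2) ^ p * (B * 2 ^ k * N k) := by ring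
      _ ≤ C * Lseq N 1 p * (1 / 2) ^ p * (B * 2 ^ k * N k) := by gcongr
      _ = Lseq N 1 p * u k p := by simp only [u]; ring
  have hder := iteratedDeriv_tsum hG (fun k => (hu k).summable) hGb
  refine ⟨fun x => ∑' p, G p x, ?_, fun x hx => ?_, funext fun k => ?_, B * C * 2 + 1,
    by positivity, fun k x => ?_⟩
  · exact contDiff_tsum hG (fun k _ => (hu k).summable) fun k p x _ =>
      norm_iteratedFDeriv_eq_norm_iteratedDeriv.trans_le (hGb k p x)
  · by_contra hx'
    refine hx ?_
    have h : ∀ p, G p x = 0 := fun p => by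
      have : g p x = 0 := by
        by_contra h
        exact hx' (hgs p h)
      simp [G, this]
    simp [h]
  · rw [BorelMap, hder]
    simp only [hGd, hg0]
    rw [tsum_eq_single k fun p hp => by rw [if_neg hp.symm, mul_zero]]
    simp
  · have hNk := hN.1 k
    rw [hder]
    refine (tsum_of_norm_bounded (hu k) fun p => hGb k p x).trans ?_
    have : 0 ≤ 2 ^ k * N k := by positivity
    nlinarith

lemma exists_slow_majorant {M : ℕ → ℝ} (hM : ∀ p, 0 < M p) {a : ℕ → ℂ}
    (ha : a ∈ LambdaBeurling M) {A : ℝ} (hA : 0 < A) :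
    ∃ ω : ℕ → ℝ, (∀ p, 0 < ω p) ∧ Monotone ω ∧ Tendsto ω atTop atTop ∧
      ∃ C > 0, ∀ p, ‖a p‖ * (A * (1 + 2 * ω p)) ^ p ≤ C * M p := by
  classical
  let P : ℕ → ℕ → Prop := fun n p => ∀ q ≥ p, ‖a q‖ * (A * (1 + 2 * ((n : ℝ) + 1))) ^ q ≤ M q
  have hP : ∀ n, ∀ᶠ p in atTop, P n p := by
    intro n
    set D : ℝ := A * (1 + 2 * ((n : ℝ) + 1)) with hD
    have hD0 : 0 < D := by positivity
    obtain ⟨C, hC, hb⟩ := ha (1 / (2 * D)) (by positivity)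
    obtain ⟨m, hm⟩ := eventually_atTop.1 ((tendsto_pow_atTop_atTop_of_one_lt
      (one_lt_two (α := ℝ))).eventually_ge_atTop C)
    filter_upwards [eventually_ge_atTop m] with p hp q hq
    have hMq := hM q
    calc ‖a q‖ * D ^ q ≤ C * (1 / (2 * D)) ^ q * M q * D ^ q := by gcongr; exact hb q
      _ = C / 2 ^ q * M q := by rw [one_div, inv_pow, mul_pow]; field_simp
      _ ≤ 1 * M q := by
        gcongr
        rw [div_le_one (by positivity)]
        exact hm q (hp.trans hq)
      _ = M q := one_mul _
  let n : ℕ → ℕ := fun p => Nat.findGreatest (fun n => P n p) p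
  have hmono : Monotone n := fun p q hpq =>
    Nat.findGreatest_mono (fun n hn r hr => hn r (hpq.trans hr)) hpq
  have htop : Tendsto n atTop atTop := tendsto_atTop.2 fun m => by
    filter_upwards [hP m, eventually_ge_atTop m] with p hp hmp
    exact Nat.le_findGreatest hmp hp
  have hmain : ∀ᶠ p in atTop, ‖a p‖ * (A * (1 + 2 * ((n p : ℝ) + 1))) ^ p ≤ M p := by
    filter_upwards [hP 0] with p hp
    exact Nat.findGreatest_spec (P := fun n => P n p) (Nat.zero_le p) hp p le_rfl
  obtain ⟨m, hm⟩ := eventually_atTop.1 hmain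
  let r : ℕ → ℝ := fun p => ‖a p‖ * (A * (1 + 2 * ((n p : ℝ) + 1))) ^ p / M p
  have hr : ∀ p, 0 ≤ r p := fun p => by
    have := hM p
    positivity
  refine ⟨fun p => (n p : ℝ) + 1, fun p => by positivity,
    fun p q hpq => by simpa using hmono hpq,
    tendsto_atTop_add_const_right _ _ (tendsto_natCast_atTop_atTop.comp htop),
    1 + ∑ p ∈ Finset.range m, r p, ?_, fun p => ?_⟩
  · have := Finset.sum_nonneg fun p (_ : p ∈ Finset.range m) => hr p
    linarith
  · rw [← div_le_iff₀ (hM p)]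
    have h0 := Finset.sum_nonneg fun p (_ : p ∈ Finset.range m) => hr p
    rcases lt_or_ge p m with hpm | hpm
    · have := Finset.single_le_sum (f := r) (fun p _ => hr p) (Finset.mem_range.2 hpm)
      change r p ≤ _
      linarith
    · have := (div_le_one (hM p)).2 (hm p hpm)
      linarith

lemma lambdaBeurling_subset (hN : IsLC N) (hnq : NQA N) {s : ℕ} (hs : 1 ≤ s) :
    LambdaBeurling (Lseq N s) ⊆ BorelMap '' DBeurling N := by
  intro a ha
  have hs0 : (0 : ℝ) < s := by exact_mod_cast hs
  obtain ⟨ω, hω, hmono, htop, C, hC, hb⟩ := exists_slow_majorant (Lseq_pos hN hnq hs) ha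
    (show 0 < 16 * Real.exp 2 * s by positivity)
  obtain ⟨W, hW, hWnq, hT, hWN, hLW⟩ := exists_minorant hN hnq (s := s) hω hmono htop
  have hjet : ∀ p, ‖a p‖ * (16 * Real.exp 2) ^ p ≤ C * Lseq W 1 p := by
    intro p
    rcases Nat.eq_zero_or_pos p with rfl | hp
    · simpa [Lseq] using hb 0
    · have hωp := hω p
      have hpos : 0 < (s : ℝ) ^ p * (1 + 2 * ω p) ^ p := by positivity
      refine le_of_mul_le_mul_right ?_ hpos
      calc ‖a p‖ * (16 * Real.exp 2) ^ p * ((s : ℝ) ^ p * (1 + 2 * ω p) ^ p)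
          = ‖a p‖ * (16 * Real.exp 2 * s * (1 + 2 * ω p)) ^ p := by
            rw [mul_pow _ (1 + 2 * ω p), mul_pow _ (s : ℝ)]; ring
        _ ≤ C * Lseq N s p := hb p
        _ ≤ C * ((s : ℝ) ^ p * (1 + 2 * ω p) ^ p * Lseq W 1 p) := by
            gcongr
            exact hLW p hp
        _ = _ := by ring
  obtain ⟨f, hf, hfs, hfa, B, hB, hfb⟩ := exists_function_of_jet hW hWnq hT hjet
  refine ⟨f, ⟨hf, hfs, fun h hh => ?_⟩, hfa⟩
  obtain ⟨K, hK, hWK⟩ := hWN (h / 2) (by positivity)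
  refine ⟨B * K, by positivity, fun k x => (hfb k x).trans ?_⟩
  calc B * 2 ^ k * W k ≤ B * 2 ^ k * (K * (h / 2) ^ k * N k) := by gcongr; exact hWK k
    _ = B * K * h ^ k * N k := by rw [div_pow]; field_simp

end Sufficiency

end BorelBeurling

theorem stmt16 (N : ℕ → ℝ) (hN : IsLC N) (hnq : NQA N) (s : ℕ) (hs : 1 ≤ s) :
    (Filter.Tendsto
        (fun p : ℕ => (Lseq N s p / (p.factorial : ℝ)) ^ ((1 : ℝ) / p))
        Filter.atTop Filter.atTop ∧
      Preceq (Lseq N s) N ∧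
      LambdaBeurling (Lseq N s) ⊆ BorelMap '' (DBeurling N)) ∧
    ∀ M : ℕ → ℝ, (∀ p, 0 < M p) →
      Filter.Tendsto
        (fun p : ℕ => (M p / (p.factorial : ℝ)) ^ ((1 : ℝ) / p))
        Filter.atTop Filter.atTop →
      Preceq M N → LambdaBeurling M ⊆ BorelMap '' (DBeurling N) →
      Preceq M (Lseq N s) := by
  exact ⟨⟨BorelBeurling.Lseq_root_tendsto hN hnq hs, BorelBeurling.Lseq_preceq hN hnq hs,
    BorelBeurling.lambdaBeurling_subset hN hnq hs⟩,
    fun _ hM _ _ hsub => BorelBeurling.preceq_of_subset hN hnq hs hM hsub⟩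
end
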